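/- arXiv:1502.06009 — 8 statements merged into one kernel-verified Lean document; each statement's English description precedes it below -/
import Mathlib

section
/- Let a_1(t), ..., a_n(t) be functions ℕ → ℤ, each an eventual quasi-polynomial of degree at most 1, and each eventually positive. Then the function t ↦ F(a_1(t), ..., a_n(t)) is an eventual quasi-polynomial of degree at most 2. That is, there exist a positive integer m, polynomials f_0, ..., f_{m-1} ∈ ℚ[x] each of degree at most 2, and a threshold N, such that for all t ≥ N, F(a_1(t), ..., a_n(t)) = f_{t mod m}(t). -/
/-- `f : ℕ → ℤ` is an eventual quasi-polynomial: for some period `m > 0` and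
component polynomials `c`, `f t = c (t % m) (t)` for all sufficiently large `t`. -/
def IsEQP (f : ℕ → ℤ) : Prop :=
  ∃ (N m : ℕ) (c : ℕ → Polynomial ℚ), 0 < m ∧
    ∀ t : ℕ, N ≤ t → (f t : ℚ) = (c (t % m)).eval (t : ℚ)

/-- `f` is an eventual quasi-polynomial of degree at most `k`. -/
def EQPDegLE (f : ℕ → ℤ) (k : ℕ) : Prop :=
  ∃ (N m : ℕ) (c : ℕ → Polynomial ℚ), 0 < m ∧ (∀ j, (c j).degree ≤ (k : ℕ)) ∧
    ∀ t : ℕ, N ≤ t → (f t : ℚ) = (c (t % m)).eval (t : ℚ)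

/-- The degree of an eventual quasi-polynomial: the least `k` such that `f` has an
eventual quasi-polynomial representation with all components of degree at most `k`. -/
noncomputable def EQPdeg (f : ℕ → ℤ) : ℕ := sInf {k | EQPDegLE f k}

/-- `f` is eventually positive. -/
def EventuallyPos (f : ℕ → ℤ) : Prop := ∃ N, ∀ t : ℕ, N ≤ t → 0 < f t

/-- `u` belongs to the numerical semigroup generated by `a 0, …, a (n-1)`. -/
def InSemigroup {n : ℕ} (a : Fin n → ℤ) (u : ℤ) : Prop :=
  ∃ p : Fin n → ℕ, u = ∑ i, (p i : ℤ) * a i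

/-- `u` belongs to the group generated by `a 0, …, a (n-1)`. -/
def InGroup {n : ℕ} (a : Fin n → ℤ) (u : ℤ) : Prop :=
  ∃ p : Fin n → ℤ, u = ∑ i, p i * a i

/-- `F` is the (generalized) Frobenius number of `a 0, …, a (n-1)`: the largest
element of the generated group that is not in the generated semigroup. -/
def IsFrobeniusNumber {n : ℕ} (a : Fin n → ℤ) (F : ℤ) : Prop :=
  IsGreatest {u : ℤ | InGroup a u ∧ ¬ InSemigroup a u} F

section EventuallyPeriodic

/-- The predicate `P` on `ℕ` is eventually periodic. -/
def EvPeriodic (P : ℕ → Prop) : Prop :=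
  ∃ m : ℕ, 0 < m ∧ ∃ N, ∀ t, N ≤ t → (P (t + m) ↔ P t)

theorem iff_add_mul_of_iff_add {P : ℕ → Prop} {m N : ℕ}
    (h : ∀ t, N ≤ t → (P (t + m) ↔ P t)) (k t : ℕ) (ht : N ≤ t) :
    P (t + m * k) ↔ P t := by
  induction k with
  | zero => simp
  | succ k ih =>
    rw [← ih, ← h (t + m * k) (by omega), Nat.mul_succ, Nat.add_assoc]

theorem EvPeriodic.uniform {ι : Type*} [Finite ι] {P : ι → ℕ → Prop}
    (h : ∀ i, EvPeriodic (P i)) :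
    ∃ m : ℕ, 0 < m ∧ ∃ N, ∀ i k t, N ≤ t → (P i (t + m * k) ↔ P i t) := by
  have := Fintype.ofFinite ι
  choose m hm N hN using h
  refine ⟨∏ i, m i, Finset.prod_pos fun i _ => hm i, ∑ i, N i, fun i k t ht => ?_⟩
  obtain ⟨c, hc⟩ := Finset.dvd_prod_of_mem m (Finset.mem_univ i)
  have hNi : N i ≤ ∑ i, N i := Finset.single_le_sum (fun _ _ => Nat.zero_le _) (Finset.mem_univ i)
  rw [hc, Nat.mul_assoc]
  exact iff_add_mul_of_iff_add (hN i) (c * k) t (hNi.trans ht)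

theorem EvPeriodic.forall {ι : Type*} [Finite ι] {P : ι → ℕ → Prop}
    (h : ∀ i, EvPeriodic (P i)) : EvPeriodic fun t => ∀ i, P i t := by
  obtain ⟨m, hm, N, hN⟩ := EvPeriodic.uniform h
  refine ⟨m, hm, N, fun t ht => forall_congr' fun i => ?_⟩
  simpa using hN i 1 t ht

theorem EvPeriodic.not {P : ℕ → Prop} (h : EvPeriodic P) : EvPeriodic fun t => ¬ P t := by
  obtain ⟨m, hm, N, hN⟩ := h
  exact ⟨m, hm, N, fun t ht => not_congr (hN t ht)⟩

theorem EvPeriodic.exists {ι : Type*} [Finite ι] {P : ι → ℕ → Prop}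
    (h : ∀ i, EvPeriodic (P i)) : EvPeriodic fun t => ∃ i, P i t := by
  obtain ⟨m, hm, N, hN⟩ := EvPeriodic.uniform h
  refine ⟨m, hm, N, fun t ht => exists_congr fun i => ?_⟩
  simpa using hN i 1 t ht

theorem EvPeriodic.and {P Q : ℕ → Prop} (hP : EvPeriodic P) (hQ : EvPeriodic Q) :
    EvPeriodic fun t => P t ∧ Q t := by
  have h := EvPeriodic.forall (ι := Bool) (P := fun b => cond b P Q) (by simp [hP, hQ])
  simpa [and_comm] using h

theorem EvPeriodic.imp {P Q : ℕ → Prop} (hP : EvPeriodic P) (hQ : EvPeriodic Q) :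
    EvPeriodic fun t => P t → Q t := by
  simpa using (hP.and hQ.not).not

theorem EvPeriodic.congr {P Q : ℕ → Prop} (hP : EvPeriodic P) (N : ℕ)
    (h : ∀ t, N ≤ t → (Q t ↔ P t)) : EvPeriodic Q := by
  obtain ⟨m, hm, M, hM⟩ := hP
  refine ⟨m, hm, max N M, fun t ht => ?_⟩
  rw [h t (by omega), h (t + m) (by omega), hM t (by omega)]

theorem evPeriodic_dvd_eval (d : ℤ) (hd : 0 < d) (p : Polynomial ℤ) :
    EvPeriodic fun t => d ∣ p.eval (t : ℤ) := by
  lift d to ℕ using hd.le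
  refine ⟨d, by exact_mod_cast hd, 0, fun t _ => ?_⟩
  have h := p.sub_dvd_eval_sub ((t + d : ℕ) : ℤ) (t : ℤ)
  rw [show ((t + d : ℕ) : ℤ) - t = d by push_cast; ring] at h
  exact (dvd_iff_dvd_of_dvd_sub h)

theorem Polynomial.eval_map_natCast_rat (p : Polynomial ℤ) (t : ℕ) :
    (p.map (Int.castRingHom ℚ)).eval (t : ℚ) = ((p.eval (t : ℤ) : ℤ) : ℚ) := by
  simp

theorem evPeriodic_nonneg_eval (p : Polynomial ℤ) :
    EvPeriodic fun t => 0 ≤ p.eval (t : ℤ) := by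
  set q : Polynomial ℚ := p.map (Int.castRingHom ℚ)
  have hpq : ∀ t : ℕ, q.eval (t : ℚ) = ((p.eval (t : ℤ) : ℤ) : ℚ) := p.eval_map_natCast_rat
  suffices h : ∃ N : ℕ, (∀ t : ℕ, N ≤ t → 0 ≤ q.eval (t : ℚ)) ∨
      (∀ t : ℕ, N ≤ t → q.eval (t : ℚ) < 0) by
    obtain ⟨N, h | h⟩ := h
    · refine ⟨1, one_pos, N, fun t ht => iff_of_true ?_ ?_⟩
      · have := h (t + 1) (by omega)
        rw [hpq] at this; exact_mod_cast this
      · have := h t ht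
        rw [hpq] at this; exact_mod_cast this
    · refine ⟨1, one_pos, N, fun t ht => iff_of_false ?_ ?_⟩
      · have := h (t + 1) (by omega)
        rw [hpq] at this; exact not_le.2 (by exact_mod_cast this)
      · have := h t ht
        rw [hpq] at this; exact not_le.2 (by exact_mod_cast this)
  rcases le_or_gt q.degree 0 with h0 | h0
  · rw [Polynomial.eq_C_of_degree_le_zero h0]
    simp only [Polynomial.eval_C]
    rcases le_or_gt 0 (q.coeff 0) with h | h
    · exact ⟨0, Or.inl fun _ _ => h⟩
    · exact ⟨0, Or.inr fun _ _ => h⟩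
  · rcases le_or_gt 0 q.leadingCoeff with h | h
    · have := (q.tendsto_atTop_of_leadingCoeff_nonneg h0 h).comp
        (tendsto_natCast_atTop_atTop (R := ℚ))
      obtain ⟨N, hN⟩ := Filter.eventually_atTop.1 (this.eventually_ge_atTop 0)
      exact ⟨N, Or.inl hN⟩
    · have := (q.tendsto_atBot_of_leadingCoeff_nonpos h0 h.le).comp
        (tendsto_natCast_atTop_atTop (R := ℚ))
      obtain ⟨N, hN⟩ := Filter.eventually_atTop.1 (this.eventually_lt_atBot 0)
      exact ⟨N, Or.inr hN⟩

/-- A function that agrees with one of finitely many polynomials, selected by eventually periodic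
predicates, is an eventual quasi-polynomial. -/
theorem EQPDegLE.of_evPeriodic_selection {ι : Type*} [Finite ι] {f : ℕ → ℤ} {k : ℕ}
    {P : ι → ℕ → Prop} (hP : ∀ i, EvPeriodic (P i)) (q : ι → Polynomial ℚ)
    (hq : ∀ i, (q i).degree ≤ (k : ℕ)) (N : ℕ) (hex : ∀ t, N ≤ t → ∃ i, P i t)
    (heq : ∀ t, N ≤ t → ∀ i, P i t → (f t : ℚ) = (q i).eval (t : ℚ)) :
    EQPDegLE f k := by
  obtain ⟨m, hm, M, hM⟩ := EvPeriodic.uniform hP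
  -- a representative of the residue class of `r` beyond both thresholds
  let rep : ℕ → ℕ := fun r => r + m * max N M
  have hrep : ∀ r, max N M ≤ rep r := fun r =>
    (Nat.le_mul_of_pos_left _ hm).trans (Nat.le_add_left _ _)
  choose sel hsel using fun r => hex (rep r) ((le_max_left _ _).trans (hrep r))
  refine ⟨max N M, m, fun r => q (sel r), hm, fun r => hq _, fun t ht => ?_⟩
  apply heq t ((le_max_left _ _).trans ht)
  have h1 := hM (sel (t % m)) (max N M) t ((le_max_right _ _).trans ht)
  have h2 := hM (sel (t % m)) (t / m) (rep (t % m)) ((le_max_right _ _).trans (hrep _))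
  rw [← h1]
  have : t + m * max N M = rep (t % m) + m * (t / m) := by
    have := Nat.mod_add_div t m
    simp only [rep]; omega
  rw [this, h2]
  exact hsel _

end EventuallyPeriodic

section Subsequence

theorem EQPDegLE.of_residue_classes {f : ℕ → ℤ} {k m : ℕ} (hm : 0 < m)
    (h : ∀ r < m, EQPDegLE (fun s => f (m * s + r)) k) : EQPDegLE f k := by
  have h' : ∀ r : Fin m, EQPDegLE (fun s => f (m * s + r)) k := fun r => h r r.2
  choose N p c hp hc hf using h'
  set M := ∏ r, p r
  have hMpos : 0 < M := Finset.prod_pos fun r _ => hp r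
  let res : ℕ → Fin m := fun t => ⟨t % m, Nat.mod_lt _ hm⟩
  refine ⟨m * (∑ r, N r + 1), m * M, fun ρ => (c (res ρ) (ρ / m % p (res ρ))).comp
    (Polynomial.C (m : ℚ)⁻¹ * Polynomial.X + Polynomial.C (-(ρ % m : ℕ) / m : ℚ)),
    Nat.mul_pos hm hMpos, fun ρ => ?_, fun t ht => ?_⟩
  · apply Polynomial.degree_le_of_natDegree_le
    refine Polynomial.natDegree_comp_le.trans ?_
    calc _ ≤ k * 1 := Nat.mul_le_mul (Polynomial.natDegree_le_of_degree_le (hc _ _))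
            Polynomial.natDegree_linear_le
      _ = k := mul_one k
  · have hres : res (t % (m * M)) = res t := by
      simp [res]
    have hdiv : t % (m * M) / m % p (res t) = t / m % p (res t) := by
      rw [Nat.mod_mul_right_div_self]
      exact Nat.mod_mod_of_dvd _ (Finset.dvd_prod_of_mem p (Finset.mem_univ _))
    have hmod : t % (m * M) % m = t % m := Nat.mod_mul_right_mod _ _ _
    have hNt : N (res t) ≤ t / m := by
      have h1 : N (res t) ≤ ∑ r, N r :=
        Finset.single_le_sum (fun _ _ => Nat.zero_le _) (Finset.mem_univ _)
      have h2 : ∑ r, N r + 1 ≤ t / m := (Nat.le_div_iff_mul_le hm).2 (by rwa [mul_comm])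
      omega
    have key := hf (res t) (t / m) hNt
    have ht' : m * (t / m) + (res t : ℕ) = t := by
      simp only [res]; exact Nat.div_add_mod t m
    simp only [ht'] at key
    simp only [hres, hdiv, hmod]
    rw [key, Polynomial.eval_comp]
    congr 1
    have hmq : (m : ℚ) ≠ 0 := by exact_mod_cast hm.ne'
    have : (t : ℚ) = m * ((t / m : ℕ) : ℚ) + ((t % m : ℕ) : ℚ) := by
      exact_mod_cast (Nat.div_add_mod t m).symm
    simp only [Polynomial.eval_add, Polynomial.eval_mul, Polynomial.eval_C, Polynomial.eval_X]
    rw [this]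
    field_simp
    ring

theorem exists_int_coeffs_of_linear {f : ℕ → ℤ} {N : ℕ} {A B : ℚ}
    (h : ∀ s, N ≤ s → (f s : ℚ) = A * s + B) :
    ∃ α β : ℤ, ∀ s, N ≤ s → f s = α * s + β := by
  have h0 := h N le_rfl
  have h1 := h (N + 1) (by omega)
  refine ⟨f (N + 1) - f N, f N - (f (N + 1) - f N) * N, fun s hs => ?_⟩
  have hs' := h s hs
  have : (f s : ℚ) = ((f (N + 1) - f N) * s + (f N - (f (N + 1) - f N) * N) : ℤ) := by
    push_cast at h1 ⊢
    rw [hs', h0, h1]; ring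
  exact_mod_cast this

/-- Along a suitable arithmetic progression, eventual quasi-polynomials of degree at most `1`
are eventually given by integer linear polynomials. -/
theorem exists_common_period_linear {ι : Type*} [Finite ι] {a : ι → ℕ → ℤ}
    (h : ∀ i, EQPDegLE (a i) 1) :
    ∃ m : ℕ, 0 < m ∧ ∃ N : ℕ, ∀ r : ℕ, ∃ α β : ι → ℤ, ∀ i s, N ≤ s →
      a i (m * s + r) = α i * s + β i := by
  have := Fintype.ofFinite ι
  choose N p c hp hc hf using h
  have hpos : 0 < ∏ i, p i := Finset.prod_pos fun i _ => hp i
  refine ⟨∏ i, p i, hpos, ∑ i, N i, fun r => ?_⟩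
  suffices H : ∀ i, ∃ α β : ℤ, ∀ s : ℕ, ∑ i, N i ≤ s → a i ((∏ i, p i) * s + r) = α * s + β by
    choose α β H using H
    exact ⟨α, β, H⟩
  intro i
  obtain ⟨d, hd⟩ := Finset.dvd_prod_of_mem p (Finset.mem_univ i)
  have hNi : N i ≤ ∑ i, N i := Finset.single_le_sum (fun _ _ => Nat.zero_le _) (Finset.mem_univ i)
  set q := c i (r % p i) with hq
  refine exists_int_coeffs_of_linear (f := fun s => a i ((∏ i, p i) * s + r))
    (A := q.coeff 1 * (∏ i, p i : ℕ)) (B := q.coeff 1 * r + q.coeff 0) fun s hs => ?_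
  have hle : s ≤ (∏ i, p i) * s := Nat.le_mul_of_pos_left _ hpos
  rw [hf i _ (by omega)]
  have hmod : ((∏ i, p i) * s + r) % p i = r % p i := by
    rw [hd, Nat.mul_assoc, Nat.mul_add_mod]
  rw [hmod, ← hq, Polynomial.eq_X_add_C_of_degree_le_one (p := q) (hc i (r % p i))]
  simp
  ring

end Subsequence

section FixedGenerators

/-- All generators `b i` are nonnegative rational combinations, with common denominator `D`, of the
two positive generators `b k` and `b l`, whose greatest common divisor divides `D`. -/
structure IsDominatingPair {n : ℕ} (b : Fin n → ℤ) (k l : Fin n) (D : ℕ) (c c' : Fin n → ℤ)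
    (x y : ℤ) : Prop where
  pos_left : 0 < b k
  pos_right : 0 < b l
  denom_pos : 0 < D
  coeff_left_nonneg : ∀ i, 0 ≤ c i
  coeff_right_nonneg : ∀ i, 0 ≤ c' i
  denom_mul : ∀ i, (D : ℤ) * b i = c i * b k + c' i * b l
  bezout : x * b k + y * b l = D

variable {n : ℕ} {b : Fin n → ℤ} {k l : Fin n} {D : ℕ} {c c' : Fin n → ℤ} {x y : ℤ}

/-- The combination of the integers `c i` with coefficients the remainders `p i`. -/
def remainderSum (p : Fin n → Fin D) (c : Fin n → ℤ) : ℤ := ∑ i, ((p i : ℕ) : ℤ) * c i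

theorem remainderSum_nonneg (p : Fin n → Fin D) (hc : ∀ i, 0 ≤ c i) : 0 ≤ remainderSum p c :=
  Finset.sum_nonneg fun i _ => mul_nonneg (Int.natCast_nonneg _) (hc i)

theorem remainderSum_le (p : Fin n → Fin D) (hc : ∀ i, 0 ≤ c i) :
    remainderSum p c ≤ D * ∑ i, c i := by
  rw [Finset.mul_sum]
  exact Finset.sum_le_sum fun i _ =>
    mul_le_mul_of_nonneg_right (by exact_mod_cast (p i).2.le) (hc i)

theorem inSemigroup_add_mul_add_mul (p : Fin n → ℕ) (i j : ℕ) :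
    InSemigroup b (∑ r, (p r : ℤ) * b r + i * b k + j * b l) := by
  refine ⟨fun r => p r + (if r = k then i else 0) + (if r = l then j else 0), ?_⟩
  simp [add_mul, Finset.sum_add_distrib]

theorem InGroup.add {u v : ℤ} (hu : InGroup b u) (hv : InGroup b v) : InGroup b (u + v) := by
  obtain ⟨p, rfl⟩ := hu
  obtain ⟨q, rfl⟩ := hv
  exact ⟨p + q, by simp [add_mul, Finset.sum_add_distrib]⟩

theorem inGroup_mul (z : ℤ) (k : Fin n) : InGroup b (z * b k) :=
  ⟨fun r => if r = k then z else 0, by simp⟩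

theorem inGroup_iff_mem_span (u : ℤ) : InGroup b u ↔ u ∈ Ideal.span (Set.range b) := by
  rw [Ideal.mem_span_range_iff_exists_fun]
  exact exists_congr fun p => eq_comm

namespace IsDominatingPair

theorem denom_mul_remainderSum (h : IsDominatingPair b k l D c c' x y) (p : Fin n → Fin D) :
    (D : ℤ) * remainderSum p b = remainderSum p c * b k + remainderSum p c' * b l := by
  simp only [remainderSum, Finset.mul_sum, Finset.sum_mul, ← Finset.sum_add_distrib]
  refine Finset.sum_congr rfl fun i _ => ?_
  linear_combination ((p i : ℕ) : ℤ) * h.denom_mul i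

theorem exists_reduction (h : IsDominatingPair b k l D c c' x y) (q : Fin n → ℤ) :
    ∃ (p : Fin n → Fin D) (i j : ℤ), ∑ r, q r * b r = remainderSum p b + i * b k + j * b l ∧
      ((∀ r, 0 ≤ q r) → 0 ≤ i ∧ 0 ≤ j) := by
  have hD : (0 : ℤ) < D := by exact_mod_cast h.denom_pos
  refine ⟨fun r => ⟨(q r % D).toNat, by have := Int.emod_lt_of_pos (q r) hD; omega⟩,
    ∑ r, q r / D * c r, ∑ r, q r / D * c' r, ?_, fun hq => ?_⟩
  · simp only [remainderSum, Finset.sum_mul, ← Finset.sum_add_distrib]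
    refine Finset.sum_congr rfl fun r _ => ?_
    rw [Int.toNat_of_nonneg (Int.emod_nonneg _ hD.ne')]
    linear_combination (-b r) * Int.emod_add_mul_ediv (q r) D + q r / D * h.denom_mul r
  · exact ⟨Finset.sum_nonneg fun r _ => mul_nonneg (Int.ediv_nonneg (hq r) hD.le)
      (h.coeff_left_nonneg r), Finset.sum_nonneg fun r _ =>
      mul_nonneg (Int.ediv_nonneg (hq r) hD.le) (h.coeff_right_nonneg r)⟩

theorem inSemigroup_iff (h : IsDominatingPair b k l D c c' x y) (u : ℤ) :
    InSemigroup b u ↔ ∃ (p : Fin n → Fin D) (i j : ℤ), 0 ≤ i ∧ 0 ≤ j ∧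
      u = remainderSum p b + i * b k + j * b l := by
  constructor
  · rintro ⟨q, rfl⟩
    obtain ⟨p, i, j, hu, hnn⟩ := h.exists_reduction fun r => (q r : ℤ)
    obtain ⟨hi, hj⟩ := hnn fun r => Int.natCast_nonneg _
    exact ⟨p, i, j, hi, hj, hu⟩
  · rintro ⟨p, i, j, hi, hj, rfl⟩
    lift i to ℕ using hi
    lift j to ℕ using hj
    exact inSemigroup_add_mul_add_mul (fun r => (p r : ℕ)) i j

theorem exists_common_multiple (h : IsDominatingPair b k l D c c' x y) {X Y : ℤ}
    (hXY : X * b k = Y * b l) : ∃ θ : ℤ, D * X = θ * b l ∧ D * Y = θ * b k :=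
  ⟨x * Y + y * X, by linear_combination (-X) * h.bezout + x * hXY,
    by linear_combination (-Y) * h.bezout - y * hXY⟩

/-- Membership of `(e₁ b_k + e₂ b_l + τ b_k b_l) / D²` in the semigroup is decided by finitely many
divisibilities and inequalities. -/
theorem inSemigroup_iff_exists_bounded (h : IsDominatingPair b k l D c c' x y) {u e₁ e₂ τ : ℤ}
    (hu : (D : ℤ) ^ 2 * u = e₁ * b k + e₂ * b l + τ * (b k * b l)) :
    InSemigroup b u ↔ ∃ (p : Fin n → Fin D)
      (θ : Set.Icc (-((D : ℤ) * (|e₁| + |e₂| + |τ|))) ((D : ℤ) * (|e₁| + |e₂| + |τ|))),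
      ((D : ℤ) ^ 3 ∣ D * e₁ - D ^ 2 * remainderSum p c - (θ : ℤ) * b l ∧
        0 ≤ D * e₁ - D ^ 2 * remainderSum p c - (θ : ℤ) * b l) ∧
      ((D : ℤ) ^ 3 ∣ ((θ : ℤ) + D * τ) * b k + D * e₂ - D ^ 2 * remainderSum p c' ∧
        0 ≤ ((θ : ℤ) + D * τ) * b k + D * e₂ - D ^ 2 * remainderSum p c') := by
  have hD : (0 : ℤ) < D := by exact_mod_cast h.denom_pos
  have hk := h.pos_left
  have hl := h.pos_right
  rw [h.inSemigroup_iff]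
  refine exists_congr fun p => ?_
  have hw := h.denom_mul_remainderSum p
  have hc := remainderSum_nonneg p h.coeff_left_nonneg
  have hc' := remainderSum_nonneg p h.coeff_right_nonneg
  generalize remainderSum p c = w at *
  generalize remainderSum p c' = w' at *
  generalize remainderSum p b = v at *
  constructor
  · rintro ⟨i, j, hi, hj, rfl⟩
    obtain ⟨θ, h₁, h₂⟩ := h.exists_common_multiple (X := e₁ - D * w - D ^ 2 * i)
      (Y := D * w' + D ^ 2 * j - e₂ - τ * b k)
      (by linear_combination D * hw - hu)
    have h₁' : D * e₁ - D ^ 2 * w - θ * b l = D ^ 3 * i := by linear_combination h₁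
    have h₂' : (θ + D * τ) * b k + D * e₂ - D ^ 2 * w' = D ^ 3 * j := by linear_combination -h₂
    have hn₁ : 0 ≤ (D : ℤ) ^ 3 * i := by positivity
    have hn₂ : 0 ≤ (D : ℤ) ^ 3 * j := by positivity
    have hw₁ : 0 ≤ (D : ℤ) ^ 2 * w := by positivity
    have hw₂ : 0 ≤ (D : ℤ) ^ 2 * w' := by positivity
    have hDe₁ : (D : ℤ) * e₁ ≤ D * |e₁| := mul_le_mul_of_nonneg_left (le_abs_self _) hD.le
    have hDe₂ : (D : ℤ) * e₂ ≤ D * |e₂| := mul_le_mul_of_nonneg_left (le_abs_self _) hD.le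
    have hDτ : (D : ℤ) * τ ≤ D * |τ| := mul_le_mul_of_nonneg_left (le_abs_self _) hD.le
    have hp₁ : 0 ≤ (D : ℤ) * |e₁| := by positivity
    have hp₂ : 0 ≤ (D : ℤ) * |e₂| := by positivity
    have hp₃ : 0 ≤ (D : ℤ) * |τ| := by positivity
    have hupper : θ ≤ D * |e₁| := by
      by_contra! hlt
      nlinarith
    have hlower : -(D * |e₂|) ≤ θ + D * τ := by
      by_contra! hlt
      nlinarith
    refine ⟨⟨θ, by constructor <;> linarith⟩, ?_⟩
    simp only
    rw [h₁', h₂']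
    exact ⟨⟨dvd_mul_right _ _, hn₁⟩, ⟨dvd_mul_right _ _, hn₂⟩⟩
  · rintro ⟨⟨θ, _⟩, ⟨⟨i, hi⟩, hi0⟩, ⟨j, hj⟩, hj0⟩
    simp only at hi hi0 hj hj0
    have hD3 : (0 : ℤ) < D ^ 3 := by positivity
    rw [hi] at hi0
    rw [hj] at hj0
    refine ⟨i, j, nonneg_of_mul_nonneg_right hi0 hD3, nonneg_of_mul_nonneg_right hj0 hD3, ?_⟩
    refine mul_left_cancel₀ hD3.ne' ?_
    linear_combination D * hu - D ^ 2 * hw + b k * hi + b l * hj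

theorem inGroup_iff_forall_dvd (h : IsDominatingPair b k l D c c' x y) (u : ℤ) :
    InGroup b u ↔ ∀ d : Set.Icc (1 : ℤ) D, (∀ i, (d : ℤ) ∣ b i) → (d : ℤ) ∣ u := by
  constructor
  · rintro ⟨p, rfl⟩ d hd
    exact Finset.dvd_sum fun i _ => dvd_mul_of_dvd_right (hd i) _
  · intro H
    have hD : (0 : ℤ) < D := by exact_mod_cast h.denom_pos
    rw [inGroup_iff_mem_span]
    set I := Ideal.span (Set.range b)
    obtain ⟨g, hg⟩ := (IsPrincipalIdealRing.principal I).principal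
    change I = Ideal.span {g} at hg
    have hdvd : ∀ i, g ∣ b i := fun i => by
      rw [← Ideal.mem_span_singleton, ← hg]
      exact Ideal.subset_span (Set.mem_range_self i)
    have hgD : g ∣ D := by
      rw [← h.bezout]
      exact dvd_add (dvd_mul_of_dvd_right (hdvd k) _) (dvd_mul_of_dvd_right (hdvd l) _)
    have hg0 : g ≠ 0 := by
      rintro rfl
      exact hD.ne' (zero_dvd_iff.1 hgD)
    have hmem : |g| ∈ Set.Icc (1 : ℤ) D :=
      ⟨Int.one_le_abs hg0, Int.le_of_dvd hD ((abs_dvd _ _).2 hgD)⟩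
    rw [hg, Ideal.mem_span_singleton]
    simpa using H ⟨|g|, hmem⟩ fun i => (abs_dvd _ _).2 (hdvd i)

/-- Elements of the group outside the semigroup are smaller than some
`remainderSum p b + b k * b l`. -/
theorem lt_of_not_inSemigroup (h : IsDominatingPair b k l D c c' x y) {u : ℤ}
    (hu : InGroup b u) (hu' : ¬ InSemigroup b u) :
    ∃ p : Fin n → Fin D, u < remainderSum p b + b k * b l := by
  have hk := h.pos_left
  have hl := h.pos_right
  obtain ⟨q, hq⟩ := hu
  obtain ⟨p, i, j, hij, -⟩ := h.exists_reduction q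
  refine ⟨p, ?_⟩
  by_contra! hle
  refine hu' ((h.inSemigroup_iff u).2 ⟨p, i % b l, j + i / b l * b k,
    Int.emod_nonneg _ hl.ne', ?_, ?_⟩)
  · have h1 := Int.emod_lt_of_pos i hl
    have h2 := Int.emod_add_mul_ediv i (b l)
    by_contra! hneg
    have : u = remainderSum p b + i % b l * b k + (j + i / b l * b k) * b l := by
      rw [hq, hij]; linear_combination (-b k) * h2
    nlinarith
  · rw [hq, hij]; linear_combination (-b k) * Int.emod_add_mul_ediv i (b l)

theorem inSemigroup_of_frobenius_lt {F u : ℤ} (hF : IsFrobeniusNumber b F) (hu : InGroup b u)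
    (hlt : F < u) : InSemigroup b u := by
  by_contra hn
  exact absurd (hF.2 ⟨hu, hn⟩) (not_le.2 hlt)

/-- A bound for the coefficients in `exists_frobenius_coeffs`. -/
def frobeniusBound (D : ℕ) (c c' : Fin n → ℤ) : ℤ :=
  D ^ 2 + 4 * D ^ 3 + 4 * D ^ 2 * (∑ i, c i + ∑ i, c' i)

theorem exists_frobenius_coeffs (h : IsDominatingPair b k l D c c' x y) {F : ℤ}
    (hF : IsFrobeniusNumber b F) :
    ∃ e₁ e₂ τ : Set.Icc (-frobeniusBound D c c') (frobeniusBound D c c'),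
      (D : ℤ) ^ 2 * F = e₁ * b k + e₂ * b l + τ * (b k * b l) := by
  have hD : (1 : ℤ) ≤ D := by exact_mod_cast h.denom_pos
  have hk := h.pos_left
  have hl := h.pos_right
  have hF' := hF.1.2
  have hS : 0 ≤ ∑ i, c i := Finset.sum_nonneg fun i _ => h.coeff_left_nonneg i
  have hS' : 0 ≤ ∑ i, c' i := Finset.sum_nonneg fun i _ => h.coeff_right_nonneg i
  have hup : ∀ r : Fin n, 0 < b r → InSemigroup b (F + D * b r) := fun r hr =>
    inSemigroup_of_frobenius_lt hF (hF.1.1.add (inGroup_mul _ _)) (by nlinarith)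
  obtain ⟨p, i, j, hi, hj, hp⟩ := (h.inSemigroup_iff _).1 (hup k hk)
  obtain ⟨q, i', j', hi', hj', hq⟩ := (h.inSemigroup_iff _).1 (hup l hl)
  obtain ⟨s, hs⟩ := h.lt_of_not_inSemigroup hF.1.1 hF'
  have hiD : i < D := by
    by_contra! hle
    exact hF' ((h.inSemigroup_iff _).2 ⟨p, i - D, j, by omega, hj, by linear_combination hp⟩)
  have hjD : j' < D := by
    by_contra! hle
    exact hF' ((h.inSemigroup_iff _).2 ⟨q, i', j' - D, hi', by omega, by linear_combination hq⟩)
  have hwp := h.denom_mul_remainderSum p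
  have hwq := h.denom_mul_remainderSum q
  have hws := h.denom_mul_remainderSum s
  have hp₁ := remainderSum_nonneg p h.coeff_left_nonneg
  have hp₂ := remainderSum_le p h.coeff_left_nonneg
  have hp₁' := remainderSum_nonneg p h.coeff_right_nonneg
  have hq₁ := remainderSum_nonneg q h.coeff_left_nonneg
  have hq₁' := remainderSum_nonneg q h.coeff_right_nonneg
  have hq₂' := remainderSum_le q h.coeff_right_nonneg
  have hs₂ := remainderSum_le s h.coeff_left_nonneg
  have hs₂' := remainderSum_le s h.coeff_right_nonneg
  unfold frobeniusBound
  generalize ∑ i, c i = S at *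
  generalize ∑ i, c' i = S' at *
  generalize remainderSum p c = w at *
  generalize remainderSum p c' = w' at *
  generalize remainderSum q c = z at *
  generalize remainderSum q c' = z' at *
  generalize remainderSum s c = g at *
  generalize remainderSum s c' = g' at *
  generalize remainderSum p b = P at *
  generalize remainderSum q b = Q at *
  generalize remainderSum s b = R at *
  set A := b k
  set B := b l
  set d : ℤ := (D : ℤ)
  obtain ⟨θ, hθ₁, hθ₂⟩ := h.exists_common_multiple (X := z + d * i' - w - d * (i - d))
    (Y := w' + d * j - z' - d * (j' - d))
    (by linear_combination d * hp - d * hq + hwp - hwq)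
  have hd2S : 0 ≤ d ^ 2 * S := by positivity
  have hd2S' : 0 ≤ d ^ 2 * S' := by positivity
  have hd2 : 0 ≤ d ^ 2 := by positivity
  have hd3 : 0 ≤ d ^ 3 := by positivity
  have hval : d ^ 2 * F = d * (w + d * (i - d)) * A + d * (z' + d * (j' - d)) * B + θ * (A * B) := by
    linear_combination d ^ 2 * hp + d * hwp + B * hθ₂
  have hmul : ∀ {v V : ℤ}, v ≤ d * V → d * v ≤ d ^ 2 * V := fun {v V} hv => by
    rw [sq, mul_assoc]
    exact mul_le_mul_of_nonneg_left hv (by linarith)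
  have hdw := hmul hp₂
  have hdz := hmul hq₂'
  have hdg := hmul hs₂
  have hdg' := hmul hs₂'
  have hdw0 : 0 ≤ d * w := by positivity
  have hdz0 : 0 ≤ d * z' := by positivity
  have hdi : d ^ 2 * i ≤ d ^ 3 := by
    rw [pow_succ d 2]
    exact mul_le_mul_of_nonneg_left hiD.le hd2
  have hdj : d ^ 2 * j' ≤ d ^ 3 := by
    rw [pow_succ d 2]
    exact mul_le_mul_of_nonneg_left hjD.le hd2
  have hdi0 : 0 ≤ d ^ 2 * i := by positivity
  have hdj0 : 0 ≤ d ^ 2 * j' := by positivity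
  have hlower : -(d ^ 2 * S') ≤ θ := by
    have hdw' : 0 ≤ d * w' := by positivity
    have hdj : 0 ≤ d ^ 2 * j := by positivity
    have hA : d ^ 2 * S' ≤ d ^ 2 * S' * A := le_mul_of_one_le_right hd2S' hk
    refine le_of_mul_le_mul_right ?_ hk
    linarith
  have hupper : θ ≤ d ^ 2 * S + d ^ 2 * S' + 2 * d ^ 3 + d ^ 2 := by
    have hAB : 0 < A * B := by positivity
    refine le_of_mul_le_mul_right ?_ hAB
    have h₁ : (d * g - d * (w + d * (i - d))) * A ≤ (d ^ 2 * S + d ^ 3) * A :=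
      mul_le_mul_of_nonneg_right (by linarith) hk.le
    have h₂ : (d * g' - d * (z' + d * (j' - d))) * B ≤ (d ^ 2 * S' + d ^ 3) * B :=
      mul_le_mul_of_nonneg_right (by linarith) hl.le
    have h₃ : (d ^ 2 * S + d ^ 3) * A ≤ (d ^ 2 * S + d ^ 3) * (A * B) :=
      mul_le_mul_of_nonneg_left (le_mul_of_one_le_right hk.le hl) (by positivity)
    have h₄ : (d ^ 2 * S' + d ^ 3) * B ≤ (d ^ 2 * S' + d ^ 3) * (A * B) :=
      mul_le_mul_of_nonneg_left (le_mul_of_one_le_left hl.le hk) (by positivity)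
    have h₅ : d ^ 2 * F ≤ d ^ 2 * (R + A * B) := mul_le_mul_of_nonneg_left hs.le hd2
    have h₆ : d ^ 2 * R = d * g * A + d * g' * B := by linear_combination d * hws
    linarith
  refine ⟨⟨d * (w + d * (i - d)), ?_, ?_⟩, ⟨d * (z' + d * (j' - d)), ?_, ?_⟩, ⟨θ, ?_, ?_⟩, hval⟩
  all_goals linarith

end IsDominatingPair

end FixedGenerators

section LinearGenerators

open Polynomial in
/-- The polynomial whose values are the candidates for `D²` times the Frobenius number. -/
noncomputable def candidatePoly (f g : ℤ[X]) (e : ℤ × ℤ × ℤ) : ℤ[X] :=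
  C e.1 * f + C e.2.1 * g + C e.2.2 * (f * g)

variable {n : ℕ} {a : Fin n → ℕ → ℤ} {k l : Fin n} {D : ℕ} {c c' : Fin n → ℤ} {x y : ℤ}
  {f : Fin n → Polynomial ℤ} {N : ℕ}

theorem eval_candidatePoly (f g : Polynomial ℤ) (e : ℤ × ℤ × ℤ) (z : ℤ) :
    (candidatePoly f g e).eval z =
      e.1 * f.eval z + e.2.1 * g.eval z + e.2.2 * (f.eval z * g.eval z) := by
  simp [candidatePoly]

theorem degree_candidatePoly_le {f g : Polynomial ℤ} (hf : f.natDegree ≤ 1) (hg : g.natDegree ≤ 1)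
    (e : ℤ × ℤ × ℤ) : (candidatePoly f g e).natDegree ≤ 2 := by
  unfold candidatePoly
  compute_degree
  omega

/-- Whether a candidate value lies in the group but outside the semigroup is eventually periodic. -/
theorem evPeriodic_isGap (hf : ∀ i t, N ≤ t → a i t = (f i).eval (t : ℤ))
    (h : ∀ t, N ≤ t → IsDominatingPair (fun i => a i t) k l D c c' x y) (e : ℤ × ℤ × ℤ) :
    EvPeriodic fun t => ∃ u : ℤ, (D : ℤ) ^ 2 * u = (candidatePoly (f k) (f l) e).eval (t : ℤ) ∧
      InGroup (fun i => a i t) u ∧ ¬ InSemigroup (fun i => a i t) u := by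
  obtain ⟨e₁, e₂, τ⟩ := e
  have hD : (0 : ℤ) < D := by exact_mod_cast (h N le_rfl).denom_pos
  have hD2 : (0 : ℤ) < (D : ℤ) ^ 2 := by positivity
  have hD3 : (0 : ℤ) < (D : ℤ) ^ 3 := by positivity
  have hdvd := evPeriodic_dvd_eval _ hD2 (candidatePoly (f k) (f l) (e₁, e₂, τ))
  have hgroup : EvPeriodic fun t => ∀ d : Set.Icc (1 : ℤ) D,
      (∀ i, (d : ℤ) ∣ (f i).eval (t : ℤ)) →
        (D : ℤ) ^ 2 * d ∣ (candidatePoly (f k) (f l) (e₁, e₂, τ)).eval (t : ℤ) :=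
    EvPeriodic.forall fun d => (EvPeriodic.forall fun i =>
      evPeriodic_dvd_eval _ (lt_of_lt_of_le one_pos d.2.1) (f i)).imp
        (evPeriodic_dvd_eval _ (mul_pos hD2 (lt_of_lt_of_le one_pos d.2.1)) _)
  let r₁ (p : Fin n → Fin D) (θ : ℤ) : Polynomial ℤ :=
    Polynomial.C (D * e₁ - D ^ 2 * remainderSum p c) - Polynomial.C θ * f l
  let r₂ (p : Fin n → Fin D) (θ : ℤ) : Polynomial ℤ :=
    Polynomial.C (θ + D * τ) * f k + Polynomial.C (D * e₂ - D ^ 2 * remainderSum p c')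
  have hsemi : EvPeriodic fun t => ∃ (p : Fin n → Fin D)
      (θ : Set.Icc (-((D : ℤ) * (|e₁| + |e₂| + |τ|))) ((D : ℤ) * (|e₁| + |e₂| + |τ|))),
      ((D : ℤ) ^ 3 ∣ (r₁ p θ).eval (t : ℤ) ∧ 0 ≤ (r₁ p θ).eval (t : ℤ)) ∧
      ((D : ℤ) ^ 3 ∣ (r₂ p θ).eval (t : ℤ) ∧ 0 ≤ (r₂ p θ).eval (t : ℤ)) :=
    EvPeriodic.exists fun p => EvPeriodic.exists fun θ =>
      ((evPeriodic_dvd_eval _ hD3 _).and (evPeriodic_nonneg_eval _)).and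
        ((evPeriodic_dvd_eval _ hD3 _).and (evPeriodic_nonneg_eval _))
  refine (hdvd.and (hgroup.and hsemi.not)).congr N fun t ht => ?_
  have hfk := hf k t ht
  have hfl := hf l t ht
  have key : ∀ u : ℤ, (D : ℤ) ^ 2 * u = (candidatePoly (f k) (f l) (e₁, e₂, τ)).eval (t : ℤ) →
      ((InGroup (fun i => a i t) u ∧ ¬ InSemigroup (fun i => a i t) u) ↔ _) := fun u hu =>
    and_congr ((h t ht).inGroup_iff_forall_dvd u)
      (not_congr ((h t ht).inSemigroup_iff_exists_bounded (e₁ := e₁) (e₂ := e₂) (τ := τ)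
        (by rw [hu, eval_candidatePoly, hfk, hfl])))
  have hr₁ : ∀ p θ, (r₁ p θ).eval (t : ℤ) =
      D * e₁ - D ^ 2 * remainderSum p c - θ * a l t := fun p θ => by
    simp [r₁, hfl]
  have hr₂ : ∀ p θ, (r₂ p θ).eval (t : ℤ) =
      (θ + D * τ) * a k t + D * e₂ - D ^ 2 * remainderSum p c' := fun p θ => by
    simp [r₂, hfk]; ring
  simp only [hr₁, hr₂, ← hf _ t ht]
  constructor
  · rintro ⟨u, hu, hgap⟩
    obtain ⟨hg, hs⟩ := (key u hu).1 hgap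
    refine ⟨⟨u, hu.symm⟩, fun d hd => ?_, hs⟩
    rw [← hu]
    exact mul_dvd_mul_left _ (hg d hd)
  · rintro ⟨⟨u, hu⟩, hg, hs⟩
    refine ⟨u, hu.symm, (key u hu.symm).2 ⟨fun d hd => ?_, hs⟩⟩
    have := hg d hd
    rw [hu] at this
    exact Int.dvd_of_mul_dvd_mul_left hD2.ne' this

theorem eqpDegLE_of_isDominatingPair (hf : ∀ i t, N ≤ t → a i t = (f i).eval (t : ℤ))
    (hfk : (f k).natDegree ≤ 1) (hfl : (f l).natDegree ≤ 1)
    (h : ∀ t, N ≤ t → IsDominatingPair (fun i => a i t) k l D c c' x y) {Fr : ℕ → ℤ}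
    (hFr : ∀ t, N ≤ t → IsFrobeniusNumber (fun i => a i t) (Fr t)) : EQPDegLE Fr 2 := by
  have hD : (0 : ℤ) < D := by exact_mod_cast (h N le_rfl).denom_pos
  have hD2 : (0 : ℤ) < (D : ℤ) ^ 2 := by positivity
  let J := Set.Icc (-IsDominatingPair.frobeniusBound D c c')
    (IsDominatingPair.frobeniusBound D c c')
  let q : J × J × J → Polynomial ℤ := fun e => candidatePoly (f k) (f l) (e.1, e.2.1, e.2.2)
  let G : J × J × J → ℕ → Prop := fun e t => ∃ u : ℤ, (D : ℤ) ^ 2 * u = (q e).eval (t : ℤ) ∧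
    InGroup (fun i => a i t) u ∧ ¬ InSemigroup (fun i => a i t) u
  have hG : ∀ e, EvPeriodic (G e) := fun e => evPeriodic_isGap hf h _
  have hcand : ∀ t, N ≤ t → ∃ e, G e t ∧ (D : ℤ) ^ 2 * Fr t = (q e).eval (t : ℤ) := by
    intro t ht
    obtain ⟨e₁, e₂, τ, he⟩ := (h t ht).exists_frobenius_coeffs (hFr t ht)
    have hval : (D : ℤ) ^ 2 * Fr t = (q (e₁, e₂, τ)).eval (t : ℤ) := by
      rw [he, eval_candidatePoly, hf k t ht, hf l t ht]
    exact ⟨(e₁, e₂, τ), ⟨Fr t, hval, (hFr t ht).1⟩, hval⟩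
  have hle : ∀ t, N ≤ t → ∀ e, G e t → (q e).eval (t : ℤ) ≤ D ^ 2 * Fr t := by
    rintro t ht e ⟨u, hu, hgap⟩
    rw [← hu]
    exact mul_le_mul_of_nonneg_left ((hFr t ht).2 hgap) hD2.le
  refine EQPDegLE.of_evPeriodic_selection
    (P := fun e t => G e t ∧ ∀ e', G e' t → 0 ≤ (q e - q e').eval (t : ℤ))
    (fun e => (hG e).and (EvPeriodic.forall fun e' => (hG e').imp (evPeriodic_nonneg_eval _)))
    (fun e => Polynomial.C ((D : ℚ) ^ 2)⁻¹ * (q e).map (Int.castRingHom ℚ)) (fun e => ?_) N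
    (fun t ht => ?_) (fun t ht e he => ?_)
  · refine Polynomial.degree_le_of_natDegree_le ((Polynomial.natDegree_C_mul_le _ _).trans ?_)
    exact Polynomial.natDegree_map_le.trans (degree_candidatePoly_le hfk hfl _)
  · obtain ⟨e, he, hval⟩ := hcand t ht
    refine ⟨e, he, fun e' he' => ?_⟩
    rw [Polynomial.eval_sub, ← hval]
    linarith [hle t ht e' he']
  · obtain ⟨e', he', hval⟩ := hcand t ht
    have h₁ := he.2 e' he'
    rw [Polynomial.eval_sub, ← hval] at h₁
    have heq : (D : ℤ) ^ 2 * Fr t = (q e).eval (t : ℤ) := by linarith [hle t ht e he.1]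
    have hDq : (D : ℚ) ≠ 0 := by exact_mod_cast hD.ne'
    rw [Polynomial.eval_mul, Polynomial.eval_C, Polynomial.eval_map_natCast_rat, ← heq]
    push_cast
    field_simp

/-- If all generators are proportional, so are the Frobenius numbers. -/
theorem frobenius_mul_le_of_proportional {b b' : Fin n → ℤ} {j : Fin n} (hb : 0 < b j)
    (hb' : 0 < b' j) (hprop : ∀ i, b i * b' j = b' i * b j) {F F' : ℤ}
    (hF : IsFrobeniusNumber b F) (hF' : IsFrobeniusNumber b' F') : F * b' j ≤ F' * b j := by
  obtain ⟨⟨q, hq⟩, hns⟩ := hF.1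
  have hscale : ∀ p : Fin n → ℤ, (∑ i, p i * b' i) * b j = (∑ i, p i * b i) * b' j := fun p => by
    rw [Finset.sum_mul, Finset.sum_mul]
    exact Finset.sum_congr rfl fun i _ => by linear_combination (-p i) * hprop i
  rw [hq, ← hscale]
  refine mul_le_mul_of_nonneg_right (hF'.2 ⟨⟨q, rfl⟩, ?_⟩) hb.le
  rintro ⟨p, hp⟩
  refine hns ⟨p, mul_right_cancel₀ hb'.ne' ?_⟩
  rw [hq, ← hscale q, hp, hscale fun i => (p i : ℤ)]

theorem eqpDegLE_of_linear (hn : 0 < n) {α β : Fin n → ℤ}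
    (ha : ∀ i t, N ≤ t → a i t = α i * t + β i) (hpos : ∀ i t, N ≤ t → 0 < a i t) {Fr : ℕ → ℤ}
    (hFr : ∀ t, N ≤ t → IsFrobeniusNumber (fun i => a i t) (Fr t)) : EQPDegLE Fr 2 := by
  have : Nonempty (Fin n) := ⟨⟨0, hn⟩⟩
  have hN : ∀ i, (0 : ℚ) < a i N := fun i => by exact_mod_cast hpos i N le_rfl
  obtain ⟨k, hk⟩ := Finite.exists_min fun i => (α i : ℚ) / a i N
  obtain ⟨l, hl⟩ := Finite.exists_max fun i => (α i : ℚ) / a i N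
  have hcross : ∀ i j, (α i : ℚ) / a i N ≤ α j / a j N → α i * β j ≤ α j * β i := by
    intro i j hij
    rw [div_le_div_iff₀ (hN i) (hN j)] at hij
    have hij' : α i * a j N ≤ α j * a i N := by exact_mod_cast hij
    rw [ha i N le_rfl, ha j N le_rfl] at hij'
    linarith
  have hkl := hcross k l (hk l)
  rcases hkl.eq_or_lt with heq | hlt
  · -- all ratios agree, so the generators are proportional
    have hprop : ∀ t, N ≤ t → ∀ i, a i t * a k N = a i N * a k t := by
      have hsame : (α k : ℚ) / a k N = α l / a l N := by
        rw [div_eq_div_iff (hN k).ne' (hN l).ne']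
        have : α k * a l N = α l * a k N := by
          rw [ha k N le_rfl, ha l N le_rfl]; linarith
        exact_mod_cast this
      intro t ht i
      have h₁ := hcross k i (hk i)
      have h₂ := hcross i k ((hl i).trans hsame.ge)
      rw [ha i t ht, ha k t ht, ha i N le_rfl, ha k N le_rfl]
      have h₃ : α k * β i = α i * β k := le_antisymm h₁ h₂
      linear_combination (N - t : ℤ) * h₃
    refine EQPDegLE.of_evPeriodic_selection (ι := Unit) (P := fun _ _ => True)
      (fun _ => ⟨1, one_pos, 0, fun _ _ => Iff.rfl⟩)
      (fun _ => Polynomial.C (Fr N / a k N * α k : ℚ) * Polynomial.X +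
        Polynomial.C (Fr N / a k N * β k : ℚ)) (fun _ => ?_) N (fun _ _ => ⟨(), trivial⟩)
      (fun t ht _ _ => ?_)
    · exact Polynomial.degree_linear_le.trans (by norm_num)
    · have hF : Fr t * a k N = Fr N * a k t := le_antisymm
        (frobenius_mul_le_of_proportional (b := fun i => a i t) (b' := fun i => a i N) (j := k)
          (hpos k t ht) (hpos k N le_rfl) (hprop t ht) (hFr t ht) (hFr N le_rfl))
        (frobenius_mul_le_of_proportional (b := fun i => a i N) (b' := fun i => a i t) (j := k)
          (hpos k N le_rfl) (hpos k t ht) (fun i => (hprop t ht i).symm) (hFr N le_rfl) (hFr t ht))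
      rw [ha k t ht] at hF
      have hFq : (Fr t : ℚ) * a k N = Fr N * (α k * t + β k) := by exact_mod_cast hF
      simp only [Polynomial.eval_add, Polynomial.eval_mul, Polynomial.eval_C, Polynomial.eval_X]
      have := (hN k).ne'
      field_simp
      linear_combination hFq
  · -- the extreme generators form a dominating pair
    obtain ⟨D, hD⟩ : ∃ D : ℕ, (D : ℤ) = α l * β k - α k * β l :=
      ⟨_, Int.toNat_of_nonneg (by linarith)⟩
    refine eqpDegLE_of_isDominatingPair (k := k) (l := l) (D := D) (x := α l) (y := -α k)
      (c := fun i => α l * β i - α i * β l) (c' := fun i => α i * β k - α k * β i)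
      (f := fun i => Polynomial.C (α i) * Polynomial.X + Polynomial.C (β i))
      (fun i t ht => by simp [ha i t ht]) Polynomial.natDegree_linear_le
      Polynomial.natDegree_linear_le (fun t ht => ?_) hFr
    refine ⟨hpos k t ht, hpos l t ht, by zify; linarith, fun i => ?_, fun i => ?_, fun i => ?_, ?_⟩
    · linarith [hcross i l (hl i)]
    · linarith [hcross k i (hk i)]
    · simp only [ha _ t ht, hD]; ring
    · simp only [ha _ t ht, hD]; ring

end LinearGenerators

/-- **Theorem (main).** If `a₁(t), …, aₙ(t)` are eventual quasi-polynomials of degree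
at most 1, each eventually positive (and not all eventually equal, with n ≥ 2), then
`t ↦ F(a₁(t), …, aₙ(t))` is an eventual quasi-polynomial of degree at most 2. -/
theorem frobenius_linear_eqp (n : ℕ) (hn : 2 ≤ n) (a : Fin n → ℕ → ℤ)
    (hdeg : ∀ i, EQPDegLE (a i) 1)
    (hpos : ∀ i, EventuallyPos (a i))
    (hne : ∃ N, ∀ t : ℕ, N ≤ t → ¬ ∀ i j : Fin n, a i t = a j t)
    (Fr : ℕ → ℤ)
    (hFr : ∃ N, ∀ t : ℕ, N ≤ t → IsFrobeniusNumber (fun i => a i t) (Fr t)) :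
    EQPDegLE Fr 2 := by
  obtain ⟨NF, hFr⟩ := hFr
  choose Np hNp using hpos
  obtain ⟨m, hm, N, hlin⟩ := exists_common_period_linear hdeg
  refine EQPDegLE.of_residue_classes hm fun r _ => ?_
  obtain ⟨α, β, hαβ⟩ := hlin r
  have hge : ∀ s, s ≤ m * s + r := fun s =>
    (Nat.le_mul_of_pos_left s hm).trans (Nat.le_add_right _ _)
  have hNi : ∀ i, Np i ≤ ∑ i, Np i := fun i =>
    Finset.single_le_sum (fun _ _ => Nat.zero_le _) (Finset.mem_univ i)
  exact eqpDegLE_of_linear (a := fun i s => a i (m * s + r)) (N := N + NF + ∑ i, Np i)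
    (by omega) (fun i s hs => hαβ i s (by omega))
    (fun i s hs => hNp i _ (by have := hge s; have := hNi i; omega))
    (fun s hs => hFr _ (by have := hge s; omega))
end

section
/- Let n ≤ 3 and let a_1(t), ..., a_n(t) be functions ℕ → ℤ, each an eventual quasi-polynomial and each eventually positive (with, for n ≥ 2, the generators not eventually all equal so that the Frobenius number is defined; for n = 1 one sets F(a_1) = −a_1). Then the function t ↦ F(a_1(t), ..., a_n(t)) is an eventual quasi-polynomial. -/
open Polynomial Filter

/-- The filter `F` on `ℕ` refines `atTop` and pins down a residue modulo every positive integer. -/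
structure IsResidueFilter (F : Filter ℕ) : Prop where
  neBot : F.NeBot
  le_atTop : F ≤ atTop
  mod_eq : ∀ m : ℕ, 0 < m → ∃ r, ∀ᶠ t in F, t % m = r

/-- `f` agrees with a rational polynomial along the filter `F`. -/
def PolyAlong (F : Filter ℕ) (f : ℕ → ℤ) : Prop :=
  ∃ p : ℚ[X], ∀ᶠ t in F, (f t : ℚ) = p.eval (t : ℚ)

theorem eventually_eval_pos {p : ℚ[X]} (hp : 0 < p.leadingCoeff) :
    ∀ᶠ t : ℕ in atTop, 0 < p.eval (t : ℚ) := by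
  rcases le_or_gt p.degree 0 with hd | hd
  · rw [eq_C_of_degree_le_zero hd] at hp ⊢
    exact Eventually.of_forall fun t => by simpa using hp
  · exact tendsto_natCast_atTop_atTop.eventually
      ((tendsto_atTop_of_leadingCoeff_nonneg p hd hp.le).eventually_gt_atTop 0)

namespace PolyAlong

variable {F : Filter ℕ} {f g h : ℕ → ℤ}

theorem congr (hf : PolyAlong F f) (hfg : ∀ᶠ t in F, g t = f t) : PolyAlong F g := by
  obtain ⟨p, hp⟩ := hf
  refine ⟨p, ?_⟩
  filter_upwards [hp, hfg] with t h1 h2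
  rw [h2, h1]

theorem const (n : ℤ) : PolyAlong F fun _ => n :=
  ⟨C (n : ℚ), by simp⟩

theorem add (hf : PolyAlong F f) (hg : PolyAlong F g) : PolyAlong F fun t => f t + g t := by
  obtain ⟨p, hp⟩ := hf
  obtain ⟨q, hq⟩ := hg
  refine ⟨p + q, ?_⟩
  filter_upwards [hp, hq] with t h1 h2
  simp [h1, h2]

theorem mul (hf : PolyAlong F f) (hg : PolyAlong F g) : PolyAlong F fun t => f t * g t := by
  obtain ⟨p, hp⟩ := hf
  obtain ⟨q, hq⟩ := hg
  refine ⟨p * q, ?_⟩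
  filter_upwards [hp, hq] with t h1 h2
  simp [h1, h2]

theorem neg (hf : PolyAlong F f) : PolyAlong F fun t => -f t := by
  obtain ⟨p, hp⟩ := hf
  refine ⟨-p, ?_⟩
  filter_upwards [hp] with t h1
  simp [h1]

theorem sub (hf : PolyAlong F f) (hg : PolyAlong F g) : PolyAlong F fun t => f t - g t := by
  simpa only [sub_eq_add_neg] using hf.add hg.neg

theorem pos_or_zero_or_neg (hF : IsResidueFilter F) (hf : PolyAlong F f) :
    (∀ᶠ t in F, 0 < f t) ∨ (∀ᶠ t in F, f t = 0) ∨ ∀ᶠ t in F, f t < 0 := by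
  obtain ⟨p, hp⟩ := hf
  rcases lt_trichotomy p.leadingCoeff 0 with h | h | h
  · right; right
    have h' : 0 < (-p).leadingCoeff := by simpa using h
    filter_upwards [hp, hF.le_atTop (eventually_eval_pos h')] with t h1 h2
    rw [eval_neg, ← h1] at h2
    exact_mod_cast neg_pos.mp h2
  · right; left
    filter_upwards [hp] with t h1
    rw [leadingCoeff_eq_zero.mp h] at h1
    simpa using h1
  · left
    filter_upwards [hp, hF.le_atTop (eventually_eval_pos h)] with t h1 h2
    rw [← h1] at h2
    exact_mod_cast h2

theorem lt_or_ge (hF : IsResidueFilter F) (hf : PolyAlong F f) (hg : PolyAlong F g) :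
    (∀ᶠ t in F, f t < g t) ∨ ∀ᶠ t in F, g t ≤ f t := by
  rcases (hf.sub hg).pos_or_zero_or_neg hF with h | h | h
  · exact .inr (h.mono fun t ht => by linarith)
  · exact .inr (h.mono fun t ht => by linarith)
  · exact .inl (h.mono fun t ht => by linarith)

theorem min (hF : IsResidueFilter F) (hf : PolyAlong F f) (hg : PolyAlong F g) :
    PolyAlong F fun t => min (f t) (g t) := by
  rcases hf.lt_or_ge hF hg with h | h
  · exact hf.congr (h.mono fun t ht => min_eq_left ht.le)
  · exact hg.congr (h.mono fun t ht => min_eq_right ht)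

end PolyAlong

/-- A polynomial that is positive along a residue filter has a positive leading coefficient. -/
theorem IsResidueFilter.leadingCoeff_pos {F : Filter ℕ} (hF : IsResidueFilter F) {p : ℚ[X]}
    (hp : ∀ᶠ t : ℕ in F, 0 < p.eval (t : ℚ)) : 0 < p.leadingCoeff := by
  have := hF.neBot
  by_contra! h
  rcases h.lt_or_eq with h | h
  · have h' : 0 < (-p).leadingCoeff := by simpa using h
    obtain ⟨t, h1, h2⟩ := (hp.and (hF.le_atTop (eventually_eval_pos h'))).exists
    rw [eval_neg] at h2
    linarith
  · obtain ⟨t, h1⟩ := hp.exists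
    rw [leadingCoeff_eq_zero.mp h] at h1
    simp at h1

theorem IsResidueFilter.leadingCoeff_nonneg {F : Filter ℕ} (hF : IsResidueFilter F) {p : ℚ[X]}
    (hp : ∀ᶠ t : ℕ in F, 0 ≤ p.eval (t : ℚ)) : 0 ≤ p.leadingCoeff := by
  have := hF.neBot
  by_contra! h
  have h' : 0 < (-p).leadingCoeff := by simpa using h
  obtain ⟨t, h1, h2⟩ := (hp.and (hF.le_atTop (eventually_eval_pos h'))).exists
  rw [eval_neg] at h2
  linarith

theorem IsResidueFilter.coeff_nonneg {F : Filter ℕ} (hF : IsResidueFilter F) {p : ℚ[X]} {d : ℕ}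
    (hp : ∀ᶠ t : ℕ in F, 0 ≤ p.eval (t : ℚ)) (hd : p.degree ≤ d) : 0 ≤ p.coeff d := by
  rcases hd.lt_or_eq with h | h
  · rw [coeff_eq_zero_of_degree_lt h]
  · have := hF.leadingCoeff_nonneg hp
    rwa [leadingCoeff, natDegree_eq_of_degree_eq_some h] at this

theorem IsResidueFilter.degree_le {F : Filter ℕ} (hF : IsResidueFilter F) {p q : ℚ[X]}
    (hp : ∀ᶠ t : ℕ in F, 0 ≤ p.eval (t : ℚ))
    (hpq : ∀ᶠ t : ℕ in F, p.eval (t : ℚ) < q.eval (t : ℚ)) : p.degree ≤ q.degree := by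
  by_contra! h
  have h1 := hF.leadingCoeff_nonneg hp
  have h2 : 0 < (q - p).leadingCoeff := hF.leadingCoeff_pos (hpq.mono fun t ht => by simpa using ht)
  rw [leadingCoeff_sub_of_degree_lt' h] at h2
  linarith

/-- Along a residue filter, the integer part of a rational polynomial is a polynomial. -/
theorem IsResidueFilter.polyAlong_floor {F : Filter ℕ} (hF : IsResidueFilter F) (p : ℚ[X]) :
    PolyAlong F fun t => ⌊p.eval (t : ℚ)⌋ := by
  obtain ⟨b, hb, hP⟩ := IsLocalization.integerNormalization_spec (nonZeroDivisors ℤ) p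
  set P := IsLocalization.integerNormalization (nonZeroDivisors ℤ) p
  have hb0 : b ≠ 0 := nonZeroDivisors.ne_zero hb
  have heval (t : ℕ) : ((P.eval (t : ℤ) : ℤ) : ℚ) = b * p.eval (t : ℚ) := by
    have := congrArg (eval (t : ℚ)) hP
    rw [← Int.cast_natCast, eval_intCast_map] at this
    simpa using this
  obtain ⟨r, hr⟩ := hF.mod_eq b.natAbs (Int.natAbs_pos.mpr hb0)
  refine ⟨p + C ((⌊p.eval (r : ℚ)⌋ : ℚ) - p.eval (r : ℚ)), ?_⟩
  filter_upwards [hr] with t ht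
  have hdvd : b ∣ (t : ℤ) - r := by
    rw [← Int.natAbs_dvd, ← ht]
    push_cast
    exact Int.dvd_self_sub_emod
  obtain ⟨k, hk⟩ := hdvd.trans (sub_dvd_eval_sub (t : ℤ) (r : ℤ) P)
  have hpt : p.eval (t : ℚ) = p.eval (r : ℚ) + k := by
    have h := congrArg (Int.cast : ℤ → ℚ) hk
    push_cast at h
    rw [heval, heval] at h
    have : (b : ℚ) ≠ 0 := by exact_mod_cast hb0
    apply mul_left_cancel₀ this
    linarith
  rw [hpt, Int.floor_add_intCast]
  simp only [hpt, eval_add, eval_C]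
  push_cast
  ring

theorem PolyAlong.ediv {F : Filter ℕ} {f g : ℕ → ℤ} (hF : IsResidueFilter F)
    (hf : PolyAlong F f) (hg : PolyAlong F g) (hpos : ∀ᶠ t in F, 0 < g t) :
    PolyAlong F fun t => f t / g t := by
  obtain ⟨p, hp⟩ := id hf
  obtain ⟨q, hq⟩ := id hg
  have hlc : 0 < q.leadingCoeff := by
    apply hF.leadingCoeff_pos
    filter_upwards [hq, hpos] with t h1 h2
    rw [← h1]
    exact_mod_cast h2
  have hq0 : q ≠ 0 := leadingCoeff_ne_zero.mp hlc.ne'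
  have hdeg : (p % q).degree < q.degree := EuclideanDomain.mod_lt p hq0
  have hlt : ∀ᶠ t : ℕ in F, (p % q).eval (t : ℚ) < q.eval (t : ℚ) := by
    have h : 0 < (q - p % q).leadingCoeff := by
      rwa [leadingCoeff_sub_of_degree_lt hdeg]
    filter_upwards [hF.le_atTop (eventually_eval_pos h)] with t ht
    simpa using ht
  have hgt : ∀ᶠ t : ℕ in F, -q.eval (t : ℚ) < (p % q).eval (t : ℚ) := by
    have h : 0 < (q + p % q).leadingCoeff := by
      rwa [leadingCoeff_add_of_degree_lt' hdeg]
    filter_upwards [hF.le_atTop (eventually_eval_pos h)] with t ht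
    rw [eval_add] at ht
    linarith
  set n : ℕ → ℤ := fun t => ⌊(p / q).eval (t : ℚ)⌋
  have hn : PolyAlong F n := hF.polyAlong_floor _
  have hbound : ∀ᶠ t in F, -g t < f t - n t * g t ∧ f t - n t * g t < 2 * g t := by
    filter_upwards [hp, hq, hpos, hlt, hgt] with t h1 h2 h3 h4 h5
    have h6 : p.eval (t : ℚ) = q.eval (t : ℚ) * (p / q).eval (t : ℚ) + (p % q).eval (t : ℚ) := by
      rw [← eval_mul, ← eval_add, EuclideanDomain.div_add_mod]
    have h7 : (n t : ℚ) ≤ (p / q).eval (t : ℚ) := Int.floor_le _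
    have h8 : (p / q).eval (t : ℚ) < n t + 1 := Int.lt_floor_add_one _
    have h9 : (0 : ℚ) < g t := by exact_mod_cast h3
    rw [← h1, ← h2] at h6
    rw [← h2] at h4 h5
    constructor
    · have : -(g t : ℚ) < f t - n t * g t := by nlinarith
      exact_mod_cast this
    · have : (f t : ℚ) - n t * g t < 2 * g t := by nlinarith
      exact_mod_cast this
  have key (c : ℤ) (h : ∀ᶠ t in F, (n t + c) * g t ≤ f t ∧ f t < (n t + c + 1) * g t) :
      PolyAlong F fun t => f t / g t := by
    refine (hn.add (const c)).congr ?_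
    filter_upwards [h, hpos] with t ht h3
    rw [Int.ediv_eq_iff_of_pos h3]
    exact ⟨ht.1, by linarith [ht.2]⟩
  rcases hf.lt_or_ge hF (hn.mul hg) with h | h
  · refine key (-1) ?_
    filter_upwards [h, hbound] with t h1 h2
    constructor <;> linarith [h2.1]
  rcases hf.lt_or_ge hF ((hn.add (const 1)).mul hg) with h' | h'
  · refine key 0 ?_
    filter_upwards [h, h'] with t h1 h2
    constructor <;> linarith
  · refine key 1 ?_
    filter_upwards [h', hbound] with t h1 h2
    constructor <;> linarith [h2.2]

theorem PolyAlong.emod {F : Filter ℕ} {f g : ℕ → ℤ} (hF : IsResidueFilter F)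
    (hf : PolyAlong F f) (hg : PolyAlong F g) (hpos : ∀ᶠ t in F, 0 < g t) :
    PolyAlong F fun t => f t % g t := by
  simpa only [Int.emod_def] using hf.sub (hg.mul (hf.ediv hF hg hpos))

/-- The Euclidean algorithm terminates on functions that are polynomial along a residue filter. -/
theorem IsResidueFilter.euclid_induction {F : Filter ℕ} (hF : IsResidueFilter F)
    {P : (ℕ → ℤ) → (ℕ → ℤ) → Prop}
    (step : ∀ f g, PolyAlong F f → PolyAlong F g → (∀ᶠ t in F, 0 ≤ g t) →
      ((∀ᶠ t in F, 0 < g t) → P g fun t => f t % g t) → P f g)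
    {f g : ℕ → ℤ} (hf : PolyAlong F f) (hg : PolyAlong F g) (hg0 : ∀ᶠ t in F, 0 ≤ g t) :
    P f g := by
  have := hF.neBot
  suffices H : ∀ (d : ℕ) (f g : ℕ → ℤ) (q : ℚ[X]), PolyAlong F f → (∀ᶠ t in F, 0 ≤ g t) →
      (∀ᶠ t in F, (g t : ℚ) = q.eval (t : ℚ)) → q.degree < d → P f g by
    obtain ⟨q, hq⟩ := hg
    exact H (q.natDegree + 1) f g q hf hg0 hq
      (degree_le_natDegree.trans_lt (by exact_mod_cast Nat.lt_succ_self _))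
  clear hf hg hg0 f g
  intro d
  induction d with
  | zero =>
    intro f g q hf hg0 hq hd
    refine step f g hf ⟨q, hq⟩ hg0 fun hpos => ?_
    have hq0 : q = 0 := by
      by_contra h
      exact absurd (zero_le_degree_iff.mpr h) (not_le.mpr (by exact_mod_cast hd))
    obtain ⟨t, h1, h2⟩ := (hq.and hpos).exists
    rw [hq0, eval_zero] at h1
    exact absurd (by exact_mod_cast h1) h2.ne'
  | succ d ih =>
    have descent : ∀ (n : ℕ) (M : ℚ) (i j : ℤ) (f g : ℕ → ℤ) (p q : ℚ[X]), 0 < M →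
        (∀ᶠ t in F, 0 ≤ g t) → (∀ᶠ t in F, g t ≤ f t) →
        (∀ᶠ t in F, (f t : ℚ) = p.eval (t : ℚ)) → (∀ᶠ t in F, (g t : ℚ) = q.eval (t : ℚ)) →
        p.degree ≤ d → q.degree ≤ d → p.coeff d * M = i → q.coeff d * M = j → i + j < n →
        P f g := by
      intro n
      induction n with
      | zero =>
        intro M i j f g p q hM hg0 hgf hp hq hpd hqd hi hj hn
        have h1 : 0 ≤ p.coeff d := hF.coeff_nonneg (by
          filter_upwards [hp, hg0, hgf] with t h1 h2 h3
          rw [← h1]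
          exact_mod_cast h2.trans h3) hpd
        have h2 : 0 ≤ q.coeff d := hF.coeff_nonneg (by
          filter_upwards [hq, hg0] with t h1 h2
          rw [← h1]
          exact_mod_cast h2) hqd
        have h3 : (0 : ℚ) ≤ i := hi ▸ mul_nonneg h1 hM.le
        have h4 : (0 : ℚ) ≤ j := hj ▸ mul_nonneg h2 hM.le
        have h3' : 0 ≤ i := by exact_mod_cast h3
        have h4' : 0 ≤ j := by exact_mod_cast h4
        push_cast at hn
        linarith
      | succ n ihn =>
        intro M i j f g p q hM hg0 hgf hp hq hpd hqd hi hj hn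
        rcases hqd.lt_or_eq with hlt | heq
        · exact ih f g q ⟨p, hp⟩ hg0 hq hlt
        refine step f g ⟨p, hp⟩ ⟨q, hq⟩ hg0 fun hpos => ?_
        obtain ⟨k, hk⟩ := PolyAlong.ediv hF ⟨p, hp⟩ ⟨q, hq⟩ hpos
        have hmod : ∀ᶠ t in F, ((f t % g t : ℤ) : ℚ) = (p - q * k).eval (t : ℚ) := by
          filter_upwards [hp, hq, hk] with t h1 h2 h3
          rw [Int.emod_def]
          push_cast
          rw [h1, h2, h3, eval_sub, eval_mul]
        have hmod0 : ∀ᶠ t in F, 0 ≤ f t % g t :=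
          hpos.mono fun t ht => Int.emod_nonneg _ ht.ne'
        have hmodlt : ∀ᶠ t in F, f t % g t < g t :=
          hpos.mono fun t ht => Int.emod_lt_of_pos _ ht
        have hrd : (p - q * k).degree ≤ d := by
          refine le_trans (hF.degree_le ?_ ?_) hqd
          · filter_upwards [hmod, hmod0] with t h1 h2
            rw [← h1]
            exact_mod_cast h2
          · filter_upwards [hmod, hmodlt, hq] with t h1 h2 h3
            rw [← h1, ← h3]
            exact_mod_cast h2
        have hq0 : q ≠ 0 := fun h => by simp [h] at heq
        have hkd : k.degree ≤ 0 := by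
          have h1 : (q * k).degree ≤ d := by
            have : q * k = p - (p - q * k) := by ring
            rw [this]
            exact (degree_sub_le _ _).trans (max_le hpd hrd)
          rw [degree_mul, heq] at h1
          by_contra! h2
          have h3 : k ≠ 0 := fun h => by simp [h] at h2
          rw [degree_eq_natDegree h3] at h1 h2
          norm_cast at h1 h2
          omega
        rw [eq_C_of_degree_le_zero hkd] at hk hmod hrd
        obtain ⟨t₀, hk0, hgf0, hpos0⟩ := (hk.and (hgf.and hpos)).exists
        set m : ℤ := f t₀ / g t₀
        rw [eval_C] at hk0
        rw [← hk0] at hmod hrd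
        have hm : 1 ≤ m := (Int.le_ediv_iff_mul_le hpos0).mpr (by linarith)
        have hqc : 0 < q.coeff d := by
          have : 0 < q.leadingCoeff := hF.leadingCoeff_pos (by
            filter_upwards [hq, hpos] with t h1 h2
            rw [← h1]
            exact_mod_cast h2)
          rwa [leadingCoeff, natDegree_eq_of_degree_eq_some heq] at this
        have hjpos : 0 < j := by
          have : (0 : ℚ) < j := hj ▸ mul_pos hqc hM
          exact_mod_cast this
        refine ihn M j (i - j * m) g (fun t => f t % g t) q _ hM hmod0
          (hmodlt.mono fun t ht => ht.le) hq hmod hqd hrd hj ?_ ?_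
        · rw [coeff_sub, coeff_mul_C]
          push_cast
          rw [← hi, ← hj]
          ring
        · push_cast at hn
          nlinarith
    intro f g q hf hg0 hq hd
    refine step f g hf ⟨q, hq⟩ hg0 fun hpos => ?_
    obtain ⟨r, hr⟩ := PolyAlong.emod hF hf ⟨q, hq⟩ hpos
    have hmod0 : ∀ᶠ t in F, 0 ≤ f t % g t :=
      hpos.mono fun t ht => Int.emod_nonneg _ ht.ne'
    have hmodlt : ∀ᶠ t in F, f t % g t < g t :=
      hpos.mono fun t ht => Int.emod_lt_of_pos _ ht
    have hqd : q.degree ≤ d := by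
      rcases eq_or_ne q 0 with rfl | hq0
      · simp
      · rw [degree_eq_natDegree hq0] at hd ⊢
        norm_cast at hd ⊢
        omega
    have hrd : r.degree ≤ d := by
      refine le_trans (hF.degree_le ?_ ?_) hqd
      · filter_upwards [hr, hmod0] with t h1 h2
        rw [← h1]
        exact_mod_cast h2
      · filter_upwards [hr, hmodlt, hq] with t h1 h2 h3
        rw [← h1, ← h3]
        exact_mod_cast h2
    obtain ⟨n, hn⟩ := exists_nat_gt
      ((q.coeff d).num * (r.coeff d).den + (r.coeff d).num * (q.coeff d).den)
    refine descent n ((q.coeff d).den * (r.coeff d).den) ((q.coeff d).num * (r.coeff d).den)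
      ((r.coeff d).num * (q.coeff d).den) g _ q r
      (by exact_mod_cast Nat.mul_pos (q.coeff d).den_pos (r.coeff d).den_pos) hmod0
      (hmodlt.mono fun t ht => ht.le) hq hr hqd hrd ?_ ?_ hn
    · push_cast
      rw [← mul_assoc, Rat.mul_den_eq_num]
    · push_cast
      rw [mul_comm ((q.coeff d).den : ℚ), ← mul_assoc, Rat.mul_den_eq_num]

/-- Two-step form of `IsResidueFilter.euclid_induction`. -/
theorem IsResidueFilter.euclid_induction_two {F : Filter ℕ} (hF : IsResidueFilter F)
    {P : (ℕ → ℤ) → (ℕ → ℤ) → Prop}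
    (step : ∀ f g, PolyAlong F f → PolyAlong F g → (∀ᶠ t in F, 0 ≤ g t) →
      ((∀ᶠ t in F, 0 < g t) → (∀ᶠ t in F, 0 < f t % g t) →
        P (fun t => f t % g t) fun t => g t % (f t % g t)) → P f g)
    {f g : ℕ → ℤ} (hf : PolyAlong F f) (hg : PolyAlong F g) (hg0 : ∀ᶠ t in F, 0 ≤ g t) :
    P f g := by
  refine (hF.euclid_induction (P := fun f g => P f g ∧
    ((∀ᶠ t in F, 0 < g t) → P g fun t => f t % g t)) ?_ hf hg hg0).1
  intro f g hf hg hg0 ih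
  exact ⟨step f g hf hg hg0 fun h => (ih h).2, fun h => (ih h).1⟩

/-- Bézout's identity for functions that are polynomial along a residue filter. -/
theorem IsResidueFilter.exists_bezout {F : Filter ℕ} (hF : IsResidueFilter F)
    {f g : ℕ → ℤ} (hf : PolyAlong F f) (hg : PolyAlong F g) (hf0 : ∀ᶠ t in F, 0 < f t)
    (hg0 : ∀ᶠ t in F, 0 ≤ g t) :
    ∃ d x y : ℕ → ℤ, PolyAlong F d ∧ PolyAlong F x ∧ PolyAlong F y ∧
      ∀ᶠ t in F, 0 < d t ∧ d t = x t * f t + y t * g t ∧ d t ∣ f t ∧ d t ∣ g t := by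
  have := hF.neBot
  revert hf0
  refine hF.euclid_induction (P := fun f g => (∀ᶠ t in F, 0 < f t) →
    ∃ d x y : ℕ → ℤ, PolyAlong F d ∧ PolyAlong F x ∧ PolyAlong F y ∧
      ∀ᶠ t in F, 0 < d t ∧ d t = x t * f t + y t * g t ∧ d t ∣ f t ∧ d t ∣ g t) ?_ hf hg hg0
  intro f g hf hg hg0 ih hf0
  rcases hg.pos_or_zero_or_neg hF with h | h | h
  · obtain ⟨d, x, y, hd, hx, hy, H⟩ := ih h h
    refine ⟨d, y, fun t => x t - y t * (f t / g t), hd, hy,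
      hx.sub (hy.mul (hf.ediv hF hg h)), ?_⟩
    filter_upwards [H] with t ⟨h1, h2, h3, h4⟩
    refine ⟨h1, ?_, ?_, h3⟩
    · rw [h2, Int.emod_def]
      ring
    · rw [← Int.emod_add_mul_ediv (f t) (g t)]
      exact dvd_add h4 (h3.mul_right _)
  · refine ⟨f, fun _ => 1, fun _ => 0, hf, .const 1, .const 0, ?_⟩
    filter_upwards [h, hf0] with t h1 h2
    simp [h1, h2]
  · obtain ⟨t, h1, h2⟩ := (h.and hg0).exists
    exact absurd h1 (not_lt.mpr h2)

/-- `(p₁, p₂)` and `(q₁, q₂)` span the lattice of all `(x, y)` with `a ∣ b x + c y`. -/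
def SpansRelations (a b c p₁ p₂ q₁ q₂ : ℤ) : Prop :=
  ∀ x y : ℤ, a ∣ b * x + c * y ↔ ∃ i j : ℤ, x = i * p₁ + j * q₁ ∧ y = i * p₂ + j * q₂

namespace SpansRelations

variable {a b c p₁ p₂ q₁ q₂ : ℤ}

theorem add_mul_left (h : SpansRelations a b c p₁ p₂ q₁ q₂) (k : ℤ) :
    SpansRelations a b c (p₁ + k * q₁) (p₂ + k * q₂) q₁ q₂ := by
  intro x y
  rw [h x y]
  constructor
  · rintro ⟨i, j, rfl, rfl⟩
    exact ⟨i, j - i * k, by ring, by ring⟩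
  · rintro ⟨i, j, rfl, rfl⟩
    exact ⟨i, j + i * k, by ring, by ring⟩

theorem swap (h : SpansRelations a b c p₁ p₂ q₁ q₂) : SpansRelations a b c q₁ q₂ p₁ p₂ := by
  intro x y
  rw [h x y]
  constructor
  · rintro ⟨i, j, rfl, rfl⟩
    exact ⟨j, i, by ring, by ring⟩
  · rintro ⟨i, j, rfl, rfl⟩
    exact ⟨j, i, by ring, by ring⟩

theorem add_mul_right (h : SpansRelations a b c p₁ p₂ q₁ q₂) (k : ℤ) :
    SpansRelations a b c p₁ p₂ (q₁ + k * p₁) (q₂ + k * p₂) :=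
  (h.swap.add_mul_left k).swap

theorem det_ne_zero (h : SpansRelations a b c p₁ p₂ q₁ q₂) (ha : 0 < a) :
    p₁ * q₂ - p₂ * q₁ ≠ 0 := by
  obtain ⟨i, j, h1, h2⟩ := (h a 0).mp ⟨b, by ring⟩
  obtain ⟨k, l, h3, h4⟩ := (h 0 a).mp ⟨c, by ring⟩
  intro h0
  have : a * a = (i * l - j * k) * (p₁ * q₂ - p₂ * q₁) := by
    have : a * a = a * a - 0 * 0 := by ring
    rw [this]
    nth_rewrite 1 [h1]
    nth_rewrite 1 [h4]
    nth_rewrite 1 [h2]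
    nth_rewrite 1 [h3]
    ring
  rw [h0, mul_zero] at this
  nlinarith

theorem left_mem (h : SpansRelations a b c p₁ p₂ q₁ q₂) : a ∣ b * p₁ + c * p₂ :=
  (h p₁ p₂).mpr ⟨1, 0, by ring, by ring⟩

theorem right_mem (h : SpansRelations a b c p₁ p₂ q₁ q₂) : a ∣ b * q₁ + c * q₂ :=
  h.swap.left_mem

end SpansRelations

/-- The vectors `(u₁, -u₂)` and `(-v₁, v₂)` form a basis of the lattice of relations that cuts out
an L-shaped set of representatives of least weight. -/
structure IsReducedBasis (a b c u₁ u₂ v₁ v₂ : ℤ) : Prop where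
  spans : SpansRelations a b c u₁ (-u₂) (-v₁) v₂
  u₂_nonneg : 0 ≤ u₂
  v₁_nonneg : 0 ≤ v₁
  v₁_le : v₁ ≤ u₁
  u₂_le : u₂ ≤ v₂
  left_weight : c * u₂ ≤ b * u₁
  right_weight : b * v₁ ≤ c * v₂

namespace IsReducedBasis

variable {a b c u₁ u₂ v₁ v₂ : ℤ}

theorem det_pos (h : IsReducedBasis a b c u₁ u₂ v₁ v₂) (ha : 0 < a) :
    0 < u₁ * v₂ - u₂ * v₁ := by
  have h1 := h.spans.det_ne_zero ha
  have h2 : 0 ≤ u₁ * v₂ - u₂ * v₁ := by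
    nlinarith [mul_le_mul h.v₁_le h.u₂_le h.u₂_nonneg (h.v₁_nonneg.trans h.v₁_le)]
  exact lt_of_le_of_ne h2 fun h3 => h1 (by linarith)

/-- Every class modulo the lattice of relations meets the L-shaped region. -/
theorem exists_representative (h : IsReducedBasis a b c u₁ u₂ v₁ v₂) (ha : 0 < a) (x y : ℤ) :
    ∃ x' y' : ℤ, 0 ≤ x' ∧ 0 ≤ y' ∧ a ∣ b * (x - x') + c * (y - y') ∧ x' < u₁ ∧ y' < v₂ ∧
      (x' < u₁ - v₁ ∨ y' < v₂ - u₂) := by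
  have hdet := h.det_pos ha
  obtain ⟨-, hu₂, hv₁, hvu, huv, -, -⟩ := id h
  have hu₁ : 0 < u₁ := by
    by_contra! h0
    nlinarith
  have hv₂ : 0 < v₂ := by
    by_contra! h0
    nlinarith
  let Good (n : ℕ) : Prop := ∃ x' y' : ℤ, 0 ≤ x' ∧ 0 ≤ y' ∧
    a ∣ b * (x - x') + c * (y - y') ∧ (n : ℤ) = (u₂ + v₂) * x' + (u₁ + v₁) * y'
  have hex : ∃ n, Good n := by
    have hx := Int.emod_nonneg x ha.ne'
    have hy := Int.emod_nonneg y ha.ne'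
    refine ⟨((u₂ + v₂) * (x % a) + (u₁ + v₁) * (y % a)).toNat, x % a, y % a, hx, hy, ?_, ?_⟩
    · exact dvd_add (Int.dvd_self_sub_emod.mul_left _) (Int.dvd_self_sub_emod.mul_left _)
    · exact Int.toNat_of_nonneg (by positivity)
  obtain ⟨n, ⟨x', y', hx', hy', hdvd, hn⟩, hmin⟩ : ∃ n, Good n ∧ ∀ m, Good m → n ≤ m := by
    classical
    exact ⟨Nat.find hex, Nat.find_spec hex, fun m hm => Nat.find_min' hex hm⟩
  have key (p q : ℤ) (hpq : a ∣ b * p + c * q) (hp : p ≤ x') (hq : q ≤ y') :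
      (u₂ + v₂) * p + (u₁ + v₁) * q ≤ 0 := by
    have h1 : 0 ≤ (u₂ + v₂) * (x' - p) + (u₁ + v₁) * (y' - q) :=
      add_nonneg (mul_nonneg (by linarith) (by linarith)) (mul_nonneg (by linarith) (by linarith))
    have := hmin ((u₂ + v₂) * (x' - p) + (u₁ + v₁) * (y' - q)).toNat
      ⟨x' - p, y' - q, by linarith, by linarith, ?_, Int.toNat_of_nonneg h1⟩
    · zify at this
      rw [Int.toNat_of_nonneg h1, hn] at this
      linarith
    · have h2 : b * (x - (x' - p)) + c * (y - (y' - q)) =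
          (b * (x - x') + c * (y - y')) + (b * p + c * q) := by ring
      rw [h2]
      exact dvd_add hdvd hpq
  have hu := h.spans.left_mem
  have hv := h.spans.right_mem
  refine ⟨x', y', hx', hy', hdvd, ?_, ?_, ?_⟩
  · by_contra! h1
    nlinarith [key u₁ (-u₂) hu h1 (by linarith)]
  · by_contra! h1
    nlinarith [key (-v₁) v₂ hv (by linarith) h1]
  · by_contra! h1
    have h2 : a ∣ b * (u₁ - v₁) + c * (v₂ - u₂) := by
      have : b * (u₁ - v₁) + c * (v₂ - u₂) = (b * u₁ + c * -u₂) + (b * -v₁ + c * v₂) := by ring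
      rw [this]
      exact dvd_add hu hv
    nlinarith [key (u₁ - v₁) (v₂ - u₂) h2 h1.1 h1.2]

/-- The two outer corners of the L-shaped region have least weight in their classes. -/
theorem weight_le (h : IsReducedBasis a b c u₁ u₂ v₁ v₂) {x y x' y' : ℤ}
    (hxy : x = u₁ - 1 ∧ y = v₂ - u₂ - 1 ∨ x = u₁ - v₁ - 1 ∧ y = v₂ - 1)
    (hx' : 0 ≤ x') (hy' : 0 ≤ y') (hdvd : a ∣ b * (x - x') + c * (y - y')) :
    b * x + c * y ≤ b * x' + c * y' := by
  obtain ⟨hs, hu₂, hv₁, hvu, huv, hwu, hwv⟩ := h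
  obtain ⟨i, j, h1, h2⟩ := (hs _ _).mp hdvd
  suffices i ≤ 0 ∧ j ≤ 0 by
    have h3 : b * x + c * y - (b * x' + c * y') =
        i * (b * u₁ - c * u₂) + j * (c * v₂ - b * v₁) := by
      linear_combination b * h1 + c * h2
    nlinarith [mul_nonneg (neg_nonneg.mpr this.1) (sub_nonneg.mpr hwu),
      mul_nonneg (neg_nonneg.mpr this.2) (sub_nonneg.mpr hwv)]
  rcases hxy with ⟨rfl, rfl⟩ | ⟨rfl, rfl⟩
  · have hx : 1 ≤ (1 - i) * u₁ + j * v₁ := by linarith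
    have hy : 1 ≤ (1 - j) * v₂ + (i - 1) * u₂ := by linarith
    have hi : i ≤ 0 := by
      by_contra! hi
      have hj : i ≤ j := by
        by_contra! hj
        nlinarith [mul_nonneg (show 0 ≤ i - 1 - j by omega) hv₁,
          mul_nonneg (show 0 ≤ i - 1 by omega) (sub_nonneg.mpr hvu)]
      nlinarith [mul_nonneg (sub_nonneg.mpr hj) (hu₂.trans huv),
        mul_nonneg (show 0 ≤ i - 1 by omega) (sub_nonneg.mpr huv)]
    refine ⟨hi, ?_⟩
    by_contra! hj
    nlinarith [mul_nonneg (show 0 ≤ j - 1 by omega) (hu₂.trans huv),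
      mul_nonneg (show 0 ≤ 1 - i by omega) hu₂]
  · have hx : 1 ≤ (1 - i) * u₁ + (j - 1) * v₁ := by linarith
    have hy : 1 ≤ (1 - j) * v₂ + i * u₂ := by linarith
    have hj : j ≤ 0 := by
      by_contra! hj
      have hi : j ≤ i := by
        by_contra! hi
        nlinarith [mul_nonneg (show 0 ≤ j - 1 - i by omega) hu₂,
          mul_nonneg (show 0 ≤ j - 1 by omega) (sub_nonneg.mpr huv)]
      nlinarith [mul_nonneg (sub_nonneg.mpr hi) (hv₁.trans hvu),
        mul_nonneg (show 0 ≤ j - 1 by omega) (sub_nonneg.mpr hvu)]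
    refine ⟨?_, hj⟩
    by_contra! hi
    nlinarith [mul_nonneg (show 0 ≤ i - 1 by omega) (hv₁.trans hvu),
      mul_nonneg (show 0 ≤ 1 - j by omega) hv₁]

/-- The Frobenius number of three positive integers in terms of a reduced basis. -/
theorem isFrobeniusNumber (h : IsReducedBasis a b c u₁ u₂ v₁ v₂) (ha : 0 < a) (hb : 0 < b)
    (hc : 0 < c) :
    IsFrobeniusNumber ![a, b, c]
      (b * (u₁ - 1) + c * (v₂ - 1) - min (c * u₂) (b * v₁) - a) := by
  constructor
  · obtain ⟨x, y, hxy, hw⟩ : ∃ x y, (x = u₁ - 1 ∧ y = v₂ - u₂ - 1 ∨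
        x = u₁ - v₁ - 1 ∧ y = v₂ - 1) ∧
        b * (u₁ - 1) + c * (v₂ - 1) - min (c * u₂) (b * v₁) = b * x + c * y := by
      rcases le_total (c * u₂) (b * v₁) with h1 | h1
      · exact ⟨_, _, .inl ⟨rfl, rfl⟩, by rw [min_eq_left h1]; ring⟩
      · exact ⟨_, _, .inr ⟨rfl, rfl⟩, by rw [min_eq_right h1]; ring⟩
    rw [hw]
    refine ⟨⟨![-1, x, y], by simp [Fin.sum_univ_three]; ring⟩, ?_⟩
    rintro ⟨p, hp⟩
    simp only [Fin.sum_univ_three, Matrix.cons_val_zero, Matrix.cons_val_one, Matrix.cons_val] at hp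
    have h1 := h.weight_le hxy (Int.natCast_nonneg (p 1)) (Int.natCast_nonneg (p 2))
      ⟨p 0 + 1, by linarith⟩
    nlinarith [mul_nonneg (Int.natCast_nonneg (p 0)) ha.le]
  · rintro n ⟨⟨p, hp⟩, hn⟩
    by_contra! hlt
    refine hn ?_
    simp only [Fin.sum_univ_three, Matrix.cons_val_zero, Matrix.cons_val_one, Matrix.cons_val] at hp
    obtain ⟨x, y, hx, hy, ⟨k, hk⟩, hxu, hyv, hL⟩ := h.exists_representative ha (p 1) (p 2)
    have hw : b * x + c * y ≤ b * (u₁ - 1) + c * (v₂ - 1) - min (c * u₂) (b * v₁) := by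
      rcases hL with hL | hL
      · nlinarith [min_le_right (c * u₂) (b * v₁),
          mul_nonneg hb.le (show 0 ≤ u₁ - v₁ - 1 - x by linarith),
          mul_nonneg hc.le (show 0 ≤ v₂ - 1 - y by linarith)]
      · nlinarith [min_le_left (c * u₂) (b * v₁),
          mul_nonneg hb.le (show 0 ≤ u₁ - 1 - x by linarith),
          mul_nonneg hc.le (show 0 ≤ v₂ - u₂ - 1 - y by linarith)]
    have hz : 0 ≤ p 0 + k := by
      by_contra! h0
      nlinarith
    refine ⟨![(p 0 + k).toNat, x.toNat, y.toNat], ?_⟩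
    simp only [Fin.sum_univ_three, Matrix.cons_val_zero, Matrix.cons_val_one, Matrix.cons_val,
      Int.toNat_of_nonneg hx, Int.toNat_of_nonneg hy, Int.toNat_of_nonneg hz]
    linarith

end IsReducedBasis

/-- The vectors `(w₁, -w₂)` and `(e₁, e₂)` form a basis of the lattice of relations, as it occurs
in the course of the reduction algorithm. -/
structure IsSignedBasis (a b c w₁ w₂ e₁ e₂ : ℤ) : Prop where
  spans : SpansRelations a b c w₁ (-w₂) e₁ e₂
  w₁_nonneg : 0 ≤ w₁
  w₂_nonneg : 0 ≤ w₂
  e₁_nonneg : 0 ≤ e₁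
  e₂_nonneg : 0 ≤ e₂
  weight : c * w₂ ≤ b * w₁

namespace IsSignedBasis

variable {a b c w₁ w₂ e₁ e₂ : ℤ}

theorem weight_pos (h : IsSignedBasis a b c w₁ w₂ e₁ e₂) (ha : 0 < a) (hb : 0 < b) (hc : 0 < c) :
    0 < b * e₁ + c * e₂ := by
  have hdet := h.spans.det_ne_zero ha
  rcases h.e₁_nonneg.lt_or_eq with h1 | h1
  · have := mul_pos hb h1
    have := mul_nonneg hc.le h.e₂_nonneg
    linarith
  rcases h.e₂_nonneg.lt_or_eq with h2 | h2
  · have := mul_pos hc h2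
    have := mul_nonneg hb.le h.e₁_nonneg
    linarith
  · simp [← h1, ← h2] at hdet

theorem w₁_pos (h : IsSignedBasis a b c w₁ w₂ e₁ e₂) (ha : 0 < a) (hc : 0 < c) : 0 < w₁ := by
  have hdet := h.spans.det_ne_zero ha
  refine h.w₁_nonneg.lt_of_ne fun h1 => hdet ?_
  have h2 := h.weight
  have h3 := h.w₂_nonneg
  rw [← h1] at h2 ⊢
  have : w₂ = 0 := by nlinarith
  simp [this]

theorem isReducedBasis (h : IsSignedBasis a b c w₁ w₂ e₁ e₂) (ha : 0 < a) (hb : 0 < b) (hc : 0 < c)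
    {k : ℤ} (hk : k = (b * w₁ - c * w₂) / (b * e₁ + c * e₂)) (hle : (k + 1) * e₁ ≤ w₁) :
    IsReducedBasis a b c (w₁ - k * e₁) (w₂ + k * e₂) (w₁ - (k + 1) * e₁) (w₂ + (k + 1) * e₂) := by
  have hpos := h.weight_pos ha hb hc
  obtain ⟨h1, h2⟩ := (Int.ediv_eq_iff_of_pos hpos).mp hk.symm
  have hk0 : 0 ≤ k := hk ▸ Int.ediv_nonneg (sub_nonneg.mpr h.weight) hpos.le
  have he₁ := h.e₁_nonneg
  have he₂ := h.e₂_nonneg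
  have hw₂ := h.w₂_nonneg
  refine ⟨?_, by positivity, by linarith, by linarith, by linarith, by linarith, by linarith⟩
  convert (h.spans.add_mul_left (-k)).add_mul_right (-1) using 1 <;> ring

theorem step_left (h : IsSignedBasis a b c w₁ w₂ e₁ e₂) (ha : 0 < a) (hb : 0 < b) (hc : 0 < c)
    {k : ℤ} (hk : k = (b * w₁ - c * w₂) / (b * e₁ + c * e₂)) (hlt : w₁ < (k + 1) * e₁)
    (he : 0 < e₁) :
    IsSignedBasis a b c (w₁ % e₁) (w₂ + w₁ / e₁ * e₂) e₁ e₂ := by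
  have hpos := h.weight_pos ha hb hc
  obtain ⟨h1, h2⟩ := (Int.ediv_eq_iff_of_pos hpos).mp hk.symm
  have hq0 : 0 ≤ w₁ / e₁ := Int.ediv_nonneg h.w₁_nonneg he.le
  have hqk : w₁ / e₁ ≤ k := Int.lt_add_one_iff.mp ((Int.ediv_lt_iff_lt_mul he).mpr hlt)
  have he₂ := h.e₂_nonneg
  have hw₂ := h.w₂_nonneg
  refine ⟨?_, Int.emod_nonneg _ he.ne', by positivity, he.le, he₂, ?_⟩
  · convert h.spans.add_mul_left (-(w₁ / e₁)) using 1
    · rw [Int.emod_def]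
      ring
    · ring
  · rw [Int.emod_def]
    nlinarith [mul_le_mul_of_nonneg_right hqk hpos.le]

theorem step_right (h : IsSignedBasis a b c w₁ w₂ e₁ e₂) (hw : 0 < w₁) :
    IsSignedBasis a b c w₁ w₂ (e₁ % w₁) (e₂ + e₁ / w₁ * w₂) := by
  have hq0 : 0 ≤ e₁ / w₁ := Int.ediv_nonneg h.e₁_nonneg hw.le
  have he₂ := h.e₂_nonneg
  have hw₂ := h.w₂_nonneg
  refine ⟨?_, hw.le, hw₂, Int.emod_nonneg _ hw.ne', by positivity, h.weight⟩
  convert h.spans.add_mul_right (-(e₁ / w₁)) using 1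
  · rw [Int.emod_def]
    ring
  · ring

end IsSignedBasis

theorem IsResidueFilter.exists_isSignedBasis {F : Filter ℕ} (hF : IsResidueFilter F)
    {a b c : ℕ → ℤ} (ha : PolyAlong F a) (hb : PolyAlong F b) (hc : PolyAlong F c)
    (ha0 : ∀ᶠ t in F, 0 < a t) (hb0 : ∀ᶠ t in F, 0 < b t) (hc0 : ∀ᶠ t in F, 0 < c t) :
    ∃ w₁ w₂ e₁ e₂ : ℕ → ℤ, PolyAlong F w₁ ∧ PolyAlong F w₂ ∧ PolyAlong F e₁ ∧ PolyAlong F e₂ ∧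
      ∀ᶠ t in F, IsSignedBasis (a t) (b t) (c t) (w₁ t) (w₂ t) (e₁ t) (e₂ t) := by
  obtain ⟨d, x, y, hd, hx, hy, hbez⟩ :=
    hF.exists_bezout ha hb ha0 (hb0.mono fun t ht => ht.le)
  obtain ⟨e, x', y', he, hx', hy', hbez'⟩ :=
    hF.exists_bezout hd hc (hbez.mono fun t ht => ht.1) (hc0.mono fun t ht => ht.le)
  have hd0 : ∀ᶠ t in F, 0 < d t := hbez.mono fun t ht => ht.1
  have he0 : ∀ᶠ t in F, 0 < e t := hbez'.mono fun t ht => ht.1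
  have hw := ha.ediv hF hd hd0
  have hw0 : ∀ᶠ t in F, 0 < a t / d t := by
    filter_upwards [hbez, ha0] with t h1 h2
    exact Int.ediv_pos_of_pos_of_dvd h2 h1.1.le h1.2.2.1
  refine ⟨fun t => a t / d t, fun _ => 0, fun t => -(y t * (c t / e t)) % (a t / d t),
    fun t => d t / e t, hw, .const 0,
    (hy.mul (hc.ediv hF he he0)).neg.emod hF hw hw0, hd.ediv hF he he0, ?_⟩
  filter_upwards [hbez, hbez', ha0, hb0, hw0] with t ⟨h1, h2, h3, h4⟩ ⟨h5, h6, h7, h8⟩ h9 h10 h11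
  generalize a t = a, b t = b, c t = c, d t = d, e t = e, x t = x, y t = y, x' t = x',
    y' t = y' at *
  obtain ⟨A, rfl⟩ := h3
  obtain ⟨B, rfl⟩ := h4
  obtain ⟨D, rfl⟩ := h7
  obtain ⟨C, rfl⟩ := h8
  simp only [Int.mul_ediv_cancel_left _ h1.ne', Int.mul_ediv_cancel_left _ h5.ne'] at h11 ⊢
  have hxy : x * A + y * B = 1 := by
    apply mul_left_cancel₀ h1.ne'
    linarith
  have hxy' : x' * D + y' * C = 1 := by
    apply mul_left_cancel₀ h5.ne'
    linarith
  have hD : 0 < D := pos_of_mul_pos_right h1 h5.le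
  obtain ⟨k, hk⟩ : A ∣ -(y * C) - -(y * C) % A := Int.dvd_self_sub_emod
  generalize hE : -(y * C) % A = E at *
  have hE0 : 0 ≤ E := hE ▸ Int.emod_nonneg _ h11.ne'
  refine ⟨fun X Y => ⟨?_, ?_⟩, h11.le, le_rfl, hE0, hD.le, by nlinarith⟩
  · rintro ⟨m, hm⟩
    have h12 : B * D * X + C * Y = D * A * m := by
      apply mul_left_cancel₀ h5.ne'
      linarith
    have h13 : D ∣ Y := by
      have : D ∣ C * Y := ⟨A * m - B * X, by linarith⟩
      exact (IsCoprime.dvd_of_dvd_mul_left ⟨x', y', hxy'⟩ this)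
    obtain ⟨j, rfl⟩ := h13
    have h14 : B * X + C * j = A * m := by
      apply mul_left_cancel₀ hD.ne'
      linarith
    have h15 : A ∣ X - j * E := by
      have : A ∣ B * (X - j * E) := by
        refine ⟨m - C * j * x + B * j * k, ?_⟩
        linear_combination h14 + B * j * hk + C * j * hxy
      exact IsCoprime.dvd_of_dvd_mul_left ⟨x, y, hxy⟩ this
    obtain ⟨i, hi⟩ := h15
    exact ⟨i, j, by linarith, by ring⟩
  · rintro ⟨i, j, rfl, rfl⟩
    refine ⟨B * i + j * (C * x - B * k), ?_⟩
    linear_combination -e * D * j * C * hxy - e * D * j * B * hk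

theorem IsResidueFilter.exists_isReducedBasis {F : Filter ℕ} (hF : IsResidueFilter F)
    {a b c : ℕ → ℤ} (ha : PolyAlong F a) (hb : PolyAlong F b) (hc : PolyAlong F c)
    (ha0 : ∀ᶠ t in F, 0 < a t) (hb0 : ∀ᶠ t in F, 0 < b t) (hc0 : ∀ᶠ t in F, 0 < c t) :
    ∃ u₁ u₂ v₁ v₂ : ℕ → ℤ, PolyAlong F u₁ ∧ PolyAlong F u₂ ∧ PolyAlong F v₁ ∧ PolyAlong F v₂ ∧
      ∀ᶠ t in F, IsReducedBasis (a t) (b t) (c t) (u₁ t) (u₂ t) (v₁ t) (v₂ t) := by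
  have := hF.neBot
  obtain ⟨w₁, w₂, e₁, e₂, hw₁, hw₂, he₁, he₂, H⟩ := hF.exists_isSignedBasis ha hb hc ha0 hb0 hc0
  refine hF.euclid_induction_two (P := fun w₁ e₁ => ∀ w₂ e₂ : ℕ → ℤ, PolyAlong F w₂ →
    PolyAlong F e₂ → (∀ᶠ t in F, IsSignedBasis (a t) (b t) (c t) (w₁ t) (w₂ t) (e₁ t) (e₂ t)) →
    ∃ u₁ u₂ v₁ v₂ : ℕ → ℤ, PolyAlong F u₁ ∧ PolyAlong F u₂ ∧ PolyAlong F v₁ ∧ PolyAlong F v₂ ∧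
      ∀ᶠ t in F, IsReducedBasis (a t) (b t) (c t) (u₁ t) (u₂ t) (v₁ t) (v₂ t)) ?_ hw₁ he₁
    (H.mono fun t ht => ht.e₁_nonneg) w₂ e₂ hw₂ he₂ H
  clear! w₁ w₂ e₁ e₂
  intro w₁ e₁ hw₁ he₁ _ ih w₂ e₂ hw₂ he₂ H
  have hpos : ∀ᶠ t in F, 0 < b t * e₁ t + c t * e₂ t := by
    filter_upwards [H, ha0, hb0, hc0] with t h h1 h2 h3
    exact h.weight_pos h1 h2 h3
  let k : ℕ → ℤ := fun t => (b t * w₁ t - c t * w₂ t) / (b t * e₁ t + c t * e₂ t)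
  have hk : PolyAlong F k :=
    ((hb.mul hw₁).sub (hc.mul hw₂)).ediv hF ((hb.mul he₁).add (hc.mul he₂)) hpos
  have hk1 := hk.add (.const 1)
  rcases hw₁.lt_or_ge hF (hk1.mul he₁) with hlt | hge
  · have he0 : ∀ᶠ t in F, 0 < e₁ t := by
      filter_upwards [H, hlt, hpos] with t h h1 h2
      have hk0 : 0 ≤ k t := Int.ediv_nonneg (sub_nonneg.mpr h.weight) h2.le
      have := h.w₁_nonneg
      by_contra! h3
      nlinarith
    have H' : ∀ᶠ t in F, IsSignedBasis (a t) (b t) (c t) (w₁ t % e₁ t)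
        (w₂ t + w₁ t / e₁ t * e₂ t) (e₁ t) (e₂ t) := by
      filter_upwards [H, ha0, hb0, hc0, hlt, he0] with t h h1 h2 h3 h4 h5
      exact h.step_left h1 h2 h3 rfl h4 h5
    have hr0 : ∀ᶠ t in F, 0 < w₁ t % e₁ t := by
      filter_upwards [H', ha0, hc0] with t h h1 h3
      exact h.w₁_pos h1 h3
    have hw₂' := hw₂.add ((hw₁.ediv hF he₁ he0).mul he₂)
    refine ih he0 hr0 _ _ hw₂'
      (he₂.add ((he₁.ediv hF (hw₁.emod hF he₁ he0) hr0).mul hw₂')) ?_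
    filter_upwards [H', hr0] with t h h1
    exact h.step_right h1
  · refine ⟨_, _, _, _, hw₁.sub (hk.mul he₁), hw₂.add (hk.mul he₂), hw₁.sub (hk1.mul he₁),
      hw₂.add (hk1.mul he₂), ?_⟩
    filter_upwards [H, ha0, hb0, hc0, hge] with t h h1 h2 h3 h4
    exact h.isReducedBasis h1 h2 h3 rfl h4

theorem IsResidueFilter.polyAlong_frobeniusNumber {F : Filter ℕ} (hF : IsResidueFilter F)
    {a b c : ℕ → ℤ} (ha : PolyAlong F a) (hb : PolyAlong F b) (hc : PolyAlong F c)
    (ha0 : ∀ᶠ t in F, 0 < a t) (hb0 : ∀ᶠ t in F, 0 < b t) (hc0 : ∀ᶠ t in F, 0 < c t)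
    {Fr : ℕ → ℤ} (hFr : ∀ᶠ t in F, IsFrobeniusNumber ![a t, b t, c t] (Fr t)) :
    PolyAlong F Fr := by
  obtain ⟨u₁, u₂, v₁, v₂, hu₁, hu₂, hv₁, hv₂, H⟩ :=
    hF.exists_isReducedBasis ha hb hc ha0 hb0 hc0
  refine ((((hb.mul (hu₁.sub (.const 1))).add (hc.mul (hv₂.sub (.const 1)))).sub
    ((hc.mul hu₂).min hF (hb.mul hv₁))).sub ha).congr ?_
  filter_upwards [H, ha0, hb0, hc0, hFr] with t h h1 h2 h3 h4
  exact h4.unique (h.isFrobeniusNumber h1 h2 h3)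

theorem IsEQP.polyAlong {F : Filter ℕ} (hF : IsResidueFilter F) {f : ℕ → ℤ} (hf : IsEQP f) :
    PolyAlong F f := by
  obtain ⟨N, m, c, hm, h⟩ := hf
  obtain ⟨r, hr⟩ := hF.mod_eq m hm
  refine ⟨c r, ?_⟩
  filter_upwards [hr, hF.le_atTop (eventually_ge_atTop N)] with t h1 h2
  rw [h t h2, h1]

/-- `f` is an eventual quasi-polynomial on the residue class of `r` modulo `M`. -/
def IsEQPOn (f : ℕ → ℤ) (M r : ℕ) : Prop :=
  ∃ (N m : ℕ) (c : ℕ → ℚ[X]), 0 < m ∧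
    ∀ t : ℕ, N ≤ t → t % M = r → (f t : ℚ) = (c (t % m)).eval (t : ℚ)

theorem IsEQPOn.of_refinement {f : ℕ → ℤ} {M K r : ℕ} (hK : 0 < K) (hMK : M ∣ K)
    (h : ∀ s, s % M = r → IsEQPOn f K s) : IsEQPOn f M r := by
  choose! N m c hm hc using h
  let m' (s : ℕ) : ℕ := if s % M = r then m s else 1
  have hm' (s : ℕ) : 0 < m' s := by
    by_cases hs : s % M = r
    · simpa [m', hs] using hm s hs
    · simp [m', hs]
  let m₀ := ∏ s ∈ Finset.range K, m' s
  refine ⟨(Finset.range K).sup N, K * m₀, fun j => c (j % K) (j % m (j % K)),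
    Nat.mul_pos hK (Finset.prod_pos fun s _ => hm' s), fun t ht htr => ?_⟩
  have hs : t % K ∈ Finset.range K := Finset.mem_range.mpr (Nat.mod_lt _ hK)
  have hsr : t % K % M = r := by rw [Nat.mod_mod_of_dvd _ hMK, htr]
  have hdvd : m (t % K) ∣ K * m₀ := by
    have h1 : m' (t % K) = m (t % K) := if_pos hsr
    exact h1 ▸ (Finset.dvd_prod_of_mem m' hs).mul_left K
  rw [hc _ hsr t ((Finset.le_sup hs).trans ht) rfl]
  dsimp only
  rw [Nat.mod_mod_of_dvd _ (dvd_mul_right K m₀), Nat.mod_mod_of_dvd _ hdvd]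

/-- A function that is polynomial along every residue filter is an eventual quasi-polynomial. -/
theorem IsEQP.of_polyAlong {f : ℕ → ℤ} (hf : ∀ F, IsResidueFilter F → PolyAlong F f) :
    IsEQP f := by
  by_contra hbad
  have hstart : ¬ IsEQPOn f (Nat.factorial 0) 0 := by
    rintro ⟨N, m, c, hm, h⟩
    exact hbad ⟨N, m, c, hm, fun t ht => h t ht (Nat.mod_one t)⟩
  have hnext (n r : ℕ) (h : ¬ IsEQPOn f n.factorial r) :
      ∃ s, s % n.factorial = r ∧ ¬ IsEQPOn f (n + 1).factorial s := by
    contrapose! h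
    exact .of_refinement (Nat.factorial_pos _) (Nat.factorial_dvd_factorial n.le_succ) h
  choose! s hs hs' using hnext
  let r : ℕ → ℕ := fun n => Nat.rec 0 s n
  have hr (n : ℕ) : ¬ IsEQPOn f n.factorial (r n) := by
    induction n with
    | zero => exact hstart
    | succ n ih => exact hs' n (r n) ih
  have hr_lt (n : ℕ) : r n < n.factorial := by
    by_contra! h
    refine hr n ⟨0, 1, fun _ => 0, one_pos, fun t _ ht => ?_⟩
    have := Nat.mod_lt t n.factorial_pos
    omega
  let S : ℕ → Set ℕ := fun n => {t | n ≤ t ∧ t % n.factorial = r n}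
  have hS : Antitone S := antitone_nat_of_succ_le fun n t ht =>
    ⟨n.le_succ.trans ht.1, by
      rw [← hs n (r n) (hr n), ← Nat.mod_mod_of_dvd t (Nat.factorial_dvd_factorial n.le_succ),
        ht.2]⟩
  have hbasis : (⨅ n, 𝓟 (S n)).HasBasis (fun _ => True) S :=
    hasBasis_iInf_principal hS.directed_ge
  have hres : IsResidueFilter (⨅ n, 𝓟 (S n)) := by
    refine ⟨hbasis.neBot_iff.mpr fun {n} _ => ?_, ?_, fun m hm => ?_⟩
    · refine ⟨r n + n.factorial * n, ?_, ?_⟩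
      · nlinarith [n.factorial_pos]
      · rw [Nat.add_mul_mod_self_left, Nat.mod_eq_of_lt (hr_lt n)]
    · refine fun A hA => ?_
      obtain ⟨N, hN⟩ := mem_atTop_sets.mp hA
      exact hbasis.mem_iff.mpr ⟨N, trivial, fun t ht => hN t ht.1⟩
    · refine ⟨r m % m, hbasis.eventually_iff.mpr ⟨m, trivial, fun t ht => ?_⟩⟩
      rw [← ht.2, Nat.mod_mod_of_dvd _ (Nat.dvd_factorial hm le_rfl)]
  obtain ⟨p, hp⟩ := hf _ hres
  obtain ⟨n, -, hn⟩ := hbasis.eventually_iff.mp hp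
  exact hr n ⟨n, 1, fun _ => p, one_pos, fun t ht htr => hn ⟨ht, htr⟩⟩

/-- The Frobenius number depends only on the group and the semigroup that are generated. -/
theorem isFrobeniusNumber_congr {m n : ℕ} {a : Fin m → ℤ} {b : Fin n → ℤ}
    (hG : ∀ u, InGroup a u ↔ InGroup b u) (hS : ∀ u, InSemigroup a u ↔ InSemigroup b u) (u : ℤ) :
    IsFrobeniusNumber a u ↔ IsFrobeniusNumber b u := by
  simp only [IsFrobeniusNumber, hG, hS]

theorem isFrobeniusNumber_one_iff (a : Fin 1 → ℤ) (u : ℤ) :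
    IsFrobeniusNumber a u ↔ IsFrobeniusNumber ![a 0, a 0, a 0] u := by
  refine isFrobeniusNumber_congr (fun u => ⟨?_, ?_⟩) (fun u => ⟨?_, ?_⟩) u
  · rintro ⟨p, rfl⟩
    exact ⟨![p 0, 0, 0], by simp [Fin.sum_univ_three]⟩
  · rintro ⟨p, rfl⟩
    exact ⟨![p 0 + p 1 + p 2], by simp [Fin.sum_univ_three]; ring⟩
  · rintro ⟨p, rfl⟩
    exact ⟨![p 0, 0, 0], by simp [Fin.sum_univ_three]⟩
  · rintro ⟨p, rfl⟩
    exact ⟨![p 0 + p 1 + p 2], by simp [Fin.sum_univ_three]; ring⟩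

theorem isFrobeniusNumber_two_iff (a : Fin 2 → ℤ) (u : ℤ) :
    IsFrobeniusNumber a u ↔ IsFrobeniusNumber ![a 0, a 1, a 1] u := by
  refine isFrobeniusNumber_congr (fun u => ⟨?_, ?_⟩) (fun u => ⟨?_, ?_⟩) u
  · rintro ⟨p, rfl⟩
    exact ⟨![p 0, p 1, 0], by simp [Fin.sum_univ_three]⟩
  · rintro ⟨p, rfl⟩
    exact ⟨![p 0, p 1 + p 2], by simp [Fin.sum_univ_three]; ring⟩
  · rintro ⟨p, rfl⟩
    exact ⟨![p 0, p 1, 0], by simp [Fin.sum_univ_three]⟩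
  · rintro ⟨p, rfl⟩
    exact ⟨![p 0, p 1 + p 2], by simp [Fin.sum_univ_three]; ring⟩

/-- **Theorem (n ≤ 3).** If `a₁(t), …, aₙ(t)` with `n ≤ 3` are eventual
quasi-polynomials, each eventually positive, then `t ↦ F(a₁(t), …, aₙ(t))` is an
eventual quasi-polynomial. -/
theorem frobenius_three_generators_eqp (n : ℕ) (hn1 : 1 ≤ n) (hn3 : n ≤ 3)
    (a : Fin n → ℕ → ℤ)
    (heqp : ∀ i, IsEQP (a i))
    (hpos : ∀ i, EventuallyPos (a i))
    (hne : 2 ≤ n → ∃ N, ∀ t : ℕ, N ≤ t → ¬ ∀ i j : Fin n, a i t = a j t)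
    (Fr : ℕ → ℤ)
    (hFr : ∃ N, ∀ t : ℕ, N ≤ t → IsFrobeniusNumber (fun i => a i t) (Fr t)) :
    IsEQP Fr := by
  refine IsEQP.of_polyAlong fun F hF => ?_
  have hpoly (i : Fin n) : PolyAlong F (a i) := (heqp i).polyAlong hF
  have hpos' (i : Fin n) : ∀ᶠ t in F, 0 < a i t := by
    obtain ⟨N, hN⟩ := hpos i
    exact hF.le_atTop (eventually_atTop.mpr ⟨N, hN⟩)
  have hFr' : ∀ᶠ t in F, IsFrobeniusNumber (fun i => a i t) (Fr t) :=
    hF.le_atTop (eventually_atTop.mpr hFr)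
  obtain rfl | rfl | rfl : n = 1 ∨ n = 2 ∨ n = 3 := by omega
  · exact hF.polyAlong_frobeniusNumber (hpoly 0) (hpoly 0) (hpoly 0) (hpos' 0) (hpos' 0) (hpos' 0)
      (hFr'.mono fun t ht => (isFrobeniusNumber_one_iff _ _).mp ht)
  · exact hF.polyAlong_frobeniusNumber (hpoly 0) (hpoly 1) (hpoly 1) (hpos' 0) (hpos' 1) (hpos' 1)
      (hFr'.mono fun t ht => (isFrobeniusNumber_two_iff _ _).mp ht)
  · refine hF.polyAlong_frobeniusNumber (hpoly 0) (hpoly 1) (hpoly 2) (hpos' 0) (hpos' 1) (hpos' 2)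
      (hFr'.mono fun t ht => ?_)
    convert ht using 1
    ext i
    fin_cases i <;> rfl
end

section
/- Let b_1 < b_2 < ⋯ < b_n be integers with n ≥ 2. Then the function t ↦ F(t + b_1, t + b_2, ..., t + b_n) is an eventual quasi-polynomial with period b_n − b_1: for each residue j modulo b_n − b_1 there is a polynomial p_j ∈ ℚ[x] such that for all sufficiently large t with t ≡ j (mod b_n − b_1), F(t + b_1, ..., t + b_n) = p_j(t). -/
/-- Coefficients of an integer combination of numbers in `[0, D]` can be reduced modulo `D`, the
remainder being a multiple of `D`. -/
lemma exists_reduced_combination {n : ℕ} {c : Fin n → ℤ} {D : ℤ} (hD : 0 < D)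
    (hc : ∀ i, 0 ≤ c i ∧ c i ≤ D) (z : Fin n → ℤ) :
    ∃ (p : Fin n → ℕ) (Q : ℤ), ∑ i, z i * c i = ∑ i, (p i : ℤ) * c i + D * Q ∧
      ∑ i, (p i : ℤ) ≤ n * D ∧ ∑ i, (p i : ℤ) * c i ≤ n * D * D ∧
      ((∀ i, 0 ≤ z i) → 0 ≤ Q) := by
  have hp : ∀ i, ((z i % D).toNat : ℤ) = z i % D := fun i =>
    Int.toNat_of_nonneg (Int.emod_nonneg _ hD.ne')
  have hlt : ∀ i, z i % D ≤ D := fun i => (Int.emod_lt_of_pos _ hD).le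
  refine ⟨fun i => (z i % D).toNat, ∑ i, (z i / D) * c i, ?_, ?_, ?_, ?_⟩
  · rw [Finset.mul_sum, ← Finset.sum_add_distrib]
    refine Finset.sum_congr rfl fun i _ => ?_
    rw [hp]
    linear_combination (-c i) * Int.emod_add_mul_ediv (z i) D
  · calc ∑ i, ((z i % D).toNat : ℤ) ≤ ∑ _i : Fin n, D :=
          Finset.sum_le_sum fun i _ => by rw [hp]; exact hlt i
      _ = n * D := by simp
  · calc ∑ i, ((z i % D).toNat : ℤ) * c i ≤ ∑ _i : Fin n, D * D :=
          Finset.sum_le_sum fun i _ => by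
            rw [hp]; exact mul_le_mul (hlt i) (hc i).2 (hc i).1 hD.le
      _ = n * D * D := by simp [mul_assoc]
  · exact fun hz => Finset.sum_nonneg fun i _ =>
      mul_nonneg (Int.ediv_nonneg (hz i) hD.le) (hc i).1

lemma inSemigroup_nonneg {n : ℕ} {c : Fin n → ℤ} (hc : ∀ i, 0 ≤ c i) {x : ℤ}
    (hx : InSemigroup c x) : 0 ≤ x := by
  obtain ⟨p, rfl⟩ := hx
  exact Finset.sum_nonneg fun i _ => mul_nonneg (Int.natCast_nonneg _) (hc i)

/-- A combination plus a nonnegative multiple of the largest generator can be padded with zeros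
to have any sufficiently large number of summands. -/
lemma exists_padded_combination {n : ℕ} {c : Fin n → ℤ} {D : ℤ} {i₀ i₁ : Fin n} (h₀ : c i₀ = 0)
    (h₁ : c i₁ = D) (p : Fin n → ℕ) {Q k : ℤ} (hQ : 0 ≤ Q) (hk : ∑ i, (p i : ℤ) + Q ≤ k) :
    ∃ q : Fin n → ℕ, ∑ i, (q i : ℤ) = k ∧
      ∑ i, (q i : ℤ) * c i = ∑ i, (p i : ℤ) * c i + D * Q := by
  lift Q to ℕ using hQ
  obtain ⟨l, hl⟩ := Int.le.dest hk
  refine ⟨p + Pi.single i₁ Q + Pi.single i₀ l, ?_, ?_⟩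
  · simp [Finset.sum_add_distrib, Pi.single_apply, hl]
  · simp [Finset.sum_add_distrib, Pi.single_apply, add_mul, h₀, h₁, mul_comm D]

/-- All large elements of the group generated by numbers in `[0, D]` lie in the semigroup. -/
lemma inSemigroup_of_inGroup_of_le {n : ℕ} {c : Fin n → ℤ} {D : ℤ} (hD : 0 < D)
    (hc : ∀ i, 0 ≤ c i ∧ c i ≤ D) {i₀ i₁ : Fin n} (h₀ : c i₀ = 0) (h₁ : c i₁ = D) {x : ℤ}
    (hx : InGroup c x) (hle : n * D * D ≤ x) : InSemigroup c x := by
  obtain ⟨z, rfl⟩ := hx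
  obtain ⟨p, Q, h, -, hp, -⟩ := exists_reduced_combination hD hc z
  have hQ : 0 ≤ Q := nonneg_of_mul_nonneg_right (a := D) (b := Q) (by linarith) hD
  obtain ⟨q, -, hq⟩ := exists_padded_combination h₀ h₁ p hQ le_rfl
  exact ⟨q, by rw [h, hq]⟩

lemma sum_mul_sub {n : ℕ} (c : Fin n → ℤ) (D : ℤ) (z : Fin n → ℤ) :
    ∑ i, z i * (D - c i) = (∑ i, z i) * D - ∑ i, z i * c i := by
  simp [mul_sub, Finset.sum_sub_distrib, Finset.sum_mul]

lemma sum_mul_add {n : ℕ} (c : Fin n → ℤ) (s : ℤ) (z : Fin n → ℤ) :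
    ∑ i, z i * (s + c i) = (∑ i, z i) * s + ∑ i, z i * c i := by
  simp [mul_add, Finset.sum_add_distrib, Finset.sum_mul]

/-- Structure of the `k`-fold sumset of a finite set with minimum `0` and maximum `D`,
for `k` large. -/
lemma exists_combination_of_inSemigroup {n : ℕ} {c : Fin n → ℤ} {D : ℤ} (hD : 0 < D)
    (hc : ∀ i, 0 ≤ c i ∧ c i ≤ D) {i₀ i₁ : Fin n} (h₀ : c i₀ = 0) (h₁ : c i₁ = D) {k r : ℤ}
    (hk : 2 * (n * D) ≤ k) (hr : InSemigroup c r)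
    (hr' : InSemigroup (fun i => D - c i) (k * D - r)) :
    ∃ q : Fin n → ℕ, ∑ i, (q i : ℤ) = k ∧ ∑ i, (q i : ℤ) * c i = r := by
  have hc' : ∀ i, 0 ≤ D - c i ∧ D - c i ≤ D := fun i => by have := hc i; omega
  obtain ⟨z, hz⟩ := hr
  obtain ⟨z', hz'⟩ := hr'
  obtain ⟨p, Q, h, hp, -, hQ⟩ := exists_reduced_combination hD hc (fun i => (z i : ℤ))
  obtain ⟨p', Q', h', hp', -, hQ'⟩ := exists_reduced_combination hD hc' (fun i => (z' i : ℤ))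
  replace hQ := hQ fun i => Int.natCast_nonneg _
  replace hQ' := hQ' fun i => Int.natCast_nonneg _
  by_cases hle : ∑ i, (p i : ℤ) + Q ≤ k
  · obtain ⟨q, hq, hq'⟩ := exists_padded_combination h₀ h₁ p hQ hle
    exact ⟨q, hq, by rw [hq', hz, h]⟩
  by_cases hle' : ∑ i, (p' i : ℤ) + Q' ≤ k
  · obtain ⟨q, hq, hq'⟩ := exists_padded_combination (c := fun i => D - c i) (i₀ := i₁)
      (i₁ := i₀) (D := D) (by simp [h₁]) (by simp [h₀]) p' hQ' hle'
    refine ⟨q, hq, ?_⟩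
    rw [sum_mul_sub, hq] at hq'
    linarith
  have h1 : 0 ≤ ∑ i, (p i : ℤ) * c i :=
    Finset.sum_nonneg fun i _ => mul_nonneg (Int.natCast_nonneg _) (hc i).1
  have h2 : 0 ≤ ∑ i, (p' i : ℤ) * (D - c i) :=
    Finset.sum_nonneg fun i _ => mul_nonneg (Int.natCast_nonneg _) (hc' i).1
  have h3 : D * (Q + Q') ≤ D * k := by linarith
  have h4 := le_of_mul_le_mul_left h3 hD
  linarith

/-- Membership in the shifted semigroup in terms of sumsets. -/
lemma inSemigroup_add_iff {n : ℕ} {c : Fin n → ℤ} {s u : ℤ} :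
    InSemigroup (fun i => s + c i) u ↔
      ∃ q : Fin n → ℕ, u = (∑ i, (q i : ℤ)) * s + ∑ i, (q i : ℤ) * c i := by
  simp only [InSemigroup, sum_mul_add]

/-- Membership in the group generated by the shifted generators. -/
lemma inGroup_add_iff {n : ℕ} {c : Fin n → ℤ} {i₀ : Fin n} (h₀ : c i₀ = 0) {s u : ℤ} :
    InGroup (fun i => s + c i) u ↔ ∃ K, InGroup c (u - K * s) := by
  simp only [InGroup, sum_mul_add]
  constructor
  · rintro ⟨z, rfl⟩
    exact ⟨∑ i, z i, z, by ring⟩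
  · rintro ⟨K, z, hz⟩
    refine ⟨z + Pi.single i₀ (K - ∑ i, z i), ?_⟩
    simp only [Pi.add_apply, Finset.sum_add_distrib, add_mul, Pi.single_apply, Finset.sum_ite_eq',
      Finset.mem_univ, if_true, ite_mul, zero_mul, h₀]
    linarith

lemma inGroup_iff_mem_span_s2 {n : ℕ} {c : Fin n → ℤ} {x : ℤ} :
    InGroup c x ↔ x ∈ Ideal.span (Set.range c) := by
  rw [Ideal.mem_span_range_iff_exists_fun]
  exact exists_congr fun p => eq_comm

lemma InGroup.reflect {n : ℕ} {c : Fin n → ℤ} {i₀ : Fin n} (h₀ : c i₀ = 0) (D : ℤ) {x : ℤ} :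
    InGroup c x → InGroup (fun i => D - c i) x := by
  simp only [inGroup_iff_mem_span_s2]
  refine fun hx => (Ideal.span_le.2 ?_ : Ideal.span (Set.range c) ≤ _) hx
  rintro _ ⟨i, rfl⟩
  have hD : D ∈ Ideal.span (Set.range fun i => D - c i) :=
    Ideal.subset_span ⟨i₀, by simp [h₀]⟩
  have hi : D - c i ∈ Ideal.span (Set.range fun i => D - c i) := Ideal.subset_span ⟨i, rfl⟩
  simpa using Ideal.sub_mem _ hD hi

/-- The multipliers carrying `σ` into an ideal of `ℤ` are the multiples of some `m`. -/
lemma exists_order_mod_ideal (I : Ideal ℤ) {D : ℤ} (hD : 0 < D) (hI : D ∈ I) (σ : ℤ) :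
    ∃ m : ℤ, 0 < m ∧ ∀ j, j * σ ∈ I ↔ m ∣ j := by
  let J : Ideal ℤ := Submodule.comap (LinearMap.mulRight ℤ σ) I
  have hJ : ∀ j, j ∈ J ↔ j * σ ∈ I := fun j => Iff.rfl
  obtain ⟨g, hg⟩ := (IsPrincipalIdealRing.principal J).principal
  have hg' : ∀ j, j ∈ J ↔ g ∣ j := fun j => by rw [hg]; exact Ideal.mem_span_singleton
  have hg0 : g ≠ 0 := by
    rintro rfl
    have := (hg' D).1 ((hJ D).2 (I.mul_mem_right _ hI))
    exact hD.ne' (zero_dvd_iff.1 this)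
  exact ⟨|g|, abs_pos.2 hg0, fun j => by rw [abs_dvd, ← hg', hJ]⟩

/-- `x` lies in the group generated by `c`, but `x` is not in the semigroup generated by `c` and
`e - x` is not in the semigroup generated by the reflected generators `D - c i`. -/
def IsDefect {n : ℕ} (c : Fin n → ℤ) (D e x : ℤ) : Prop :=
  InGroup c x ∧ ¬ InSemigroup c x ∧ ¬ InSemigroup (fun i => D - c i) (e - x)

lemma IsDefect.bounds {n : ℕ} {c : Fin n → ℤ} {D : ℤ} (hD : 0 < D)
    (hc : ∀ i, 0 ≤ c i ∧ c i ≤ D) {i₀ i₁ : Fin n} (h₀ : c i₀ = 0) (h₁ : c i₁ = D) {e x : ℤ}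
    (he : InGroup c e) (h : IsDefect c D e x) : x < n * D * D ∧ e - x < n * D * D := by
  obtain ⟨hx, hS, hS'⟩ := h
  have hex : InGroup c (e - x) := by
    rw [inGroup_iff_mem_span_s2] at *
    exact Ideal.sub_mem _ he hx
  refine ⟨lt_of_not_ge fun hle => hS (inSemigroup_of_inGroup_of_le hD hc h₀ h₁ hx hle),
    lt_of_not_ge fun hle => hS' ?_⟩
  exact inSemigroup_of_inGroup_of_le hD (fun i => by have := hc i; omega) (i₀ := i₁) (i₁ := i₀)
    (by simp [h₁]) (by simp [h₀]) (hex.reflect h₀ D) hle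

/-- There is a lexicographically largest defect with `e` in a given residue class. -/
lemma exists_max_isDefect {n : ℕ} {c : Fin n → ℤ} {D : ℤ} (hD : 0 < D)
    (hc : ∀ i, 0 ≤ c i ∧ c i ≤ D) {i₀ i₁ : Fin n} (h₀ : c i₀ = 0) (h₁ : c i₁ = D) {a : ℤ}
    (ha : InGroup c a) :
    ∃ e x, D ∣ e + a ∧ -2 * D ≤ e ∧ IsDefect c D e x ∧
      ∀ e' x', D ∣ e' + a → IsDefect c D e' x' → e' ≤ e ∧ (e' = e → x' ≤ x) := by
  have hDG : InGroup c D := inGroup_iff_mem_span_s2.2 (Ideal.subset_span ⟨i₁, h₁⟩)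
  have hG : ∀ e, D ∣ e + a → InGroup c e := fun e ⟨k, hk⟩ => by
    rw [inGroup_iff_mem_span_s2] at *
    rw [show e = k * D - a by linarith]
    exact Ideal.sub_mem _ (Ideal.mul_mem_left _ _ hDG) ha
  have hinit : ∃ e, -2 * D ≤ e ∧ D ∣ e + a ∧ ∃ x, IsDefect c D e x := by
    have hlt := Int.emod_lt_of_pos (-a) hD
    have hge := Int.emod_nonneg (-a) hD.ne'
    refine ⟨-a % D - 2 * D, by linarith, ?_, -D, ?_, fun h => ?_, fun h => ?_⟩
    · refine ⟨-(-a / D) - 2, ?_⟩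
      linear_combination Int.emod_add_mul_ediv (-a) D
    · rw [inGroup_iff_mem_span_s2] at *
      exact Ideal.neg_mem_iff _ |>.2 hDG
    · have := inSemigroup_nonneg (fun i => (hc i).1) h
      linarith
    · have := inSemigroup_nonneg (fun i => sub_nonneg.2 (hc i).2) h
      linarith
  obtain ⟨e₀, he₀, he₀'⟩ := hinit
  obtain ⟨e, ⟨hea, x₀, hx₀⟩, hmax⟩ := Int.exists_greatest_of_bdd
    (P := fun e => D ∣ e + a ∧ ∃ x, IsDefect c D e x)
    ⟨2 * (n * D * D), fun e ⟨he, x, hx⟩ => by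
      have := hx.bounds hD hc h₀ h₁ (hG e he)
      linarith⟩ ⟨e₀, he₀'⟩
  obtain ⟨x, hx, hxmax⟩ := Int.exists_greatest_of_bdd (P := fun x => IsDefect c D e x)
    ⟨n * D * D, fun x hx => (hx.bounds hD hc h₀ h₁ (hG e hea)).1.le⟩ ⟨x₀, hx₀⟩
  refine ⟨e, x, hea, he₀.trans (hmax e₀ he₀'), hx, fun e' y he' hy => ⟨hmax e' ⟨he', y, hy⟩, ?_⟩⟩
  rintro rfl
  exact hxmax y hy

/-- On each residue class modulo `D`, the Frobenius number of the shifted generators `s + c i` is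
given, for large `s`, by an explicit quadratic formula. -/
lemma isFrobeniusNumber_shift {n : ℕ} {c : Fin n → ℤ} {D : ℤ} (hD : 0 < D)
    (hc : ∀ i, 0 ≤ c i ∧ c i ≤ D) {i₀ i₁ : Fin n} (h₀ : c i₀ = 0) (h₁ : c i₁ = D) (σ : ℤ) :
    ∃ m e x : ℤ, ∀ s, 3 * (n * D * D) + 3 * D ≤ s → D ∣ s - σ →
      ∃ k, D * k = e + m * s ∧ IsFrobeniusNumber (fun i => s + c i) ((k + m) * s + x) := by
  have hDG : D ∈ Ideal.span (Set.range c) := Ideal.subset_span ⟨i₁, h₁⟩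
  obtain ⟨m, hm, hmσ⟩ := exists_order_mod_ideal _ hD hDG σ
  obtain ⟨e, x, hea, he, hx, hmax⟩ := exists_max_isDefect hD hc h₀ h₁ (a := m * σ)
    (inGroup_iff_mem_span_s2.2 ((hmσ m).2 dvd_rfl))
  refine ⟨m, e, x, fun s hs hsσ => ?_⟩
  obtain ⟨w, hw⟩ := hsσ
  obtain rfl : s = σ + D * w := by linarith
  set s := σ + D * w with hs_def
  have hms : ∀ j, j * s ∈ Ideal.span (Set.range c) ↔ m ∣ j := fun j => by
    rw [← hmσ, hs_def, show j * (σ + D * w) = j * σ + (j * w) * D by ring]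
    exact Ideal.add_mem_iff_left _ (Ideal.mul_mem_left _ _ hDG)
  have hdvd : ∀ e', D ∣ e' + m * σ ↔ D ∣ e' + m * s := fun e' => by
    rw [hs_def, show e' + m * (σ + D * w) = e' + m * σ + D * (m * w) by ring]
    exact (dvd_add_left (dvd_mul_right _ _)).symm
  obtain ⟨k, hk⟩ := (hdvd e).1 hea
  have hmsG : m * s ∈ Ideal.span (Set.range c) := (hms m).2 dvd_rfl
  have heG : InGroup c e := by
    rw [inGroup_iff_mem_span_s2, show e = k * D - m * s by linarith]
    exact Ideal.sub_mem _ (Ideal.mul_mem_left _ _ hDG) hmsG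
  obtain ⟨hxC, hexC⟩ := hx.bounds hD hc h₀ h₁ heG
  have hC : 0 ≤ (n : ℤ) * D * D := by positivity
  set C := (n : ℤ) * D * D with hC_def
  have hspos : 0 < s := by linarith
  have hsm : s ≤ m * s := le_mul_of_one_le_left hspos.le hm
  have hDm : D ≤ m * D := le_mul_of_one_le_left hD.le hm
  have hxG := inGroup_iff_mem_span_s2.1 hx.1
  refine ⟨k, hk.symm, ⟨(inGroup_add_iff h₀).2 ⟨k + m, by simpa using hx.1⟩, ?_⟩, ?_⟩
  · rw [inSemigroup_add_iff]
    rintro ⟨q, hq⟩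
    set r := ∑ i, (q i : ℤ) * c i with hr
    set K := ∑ i, (q i : ℤ) with hK
    have hrS : InSemigroup c r := ⟨q, rfl⟩
    have hrS' : InSemigroup (fun i => D - c i) (K * D - r) := ⟨q, by rw [sum_mul_sub]⟩
    have hr0 := inSemigroup_nonneg (fun i => (hc i).1) hrS
    have hr1 := inSemigroup_nonneg (fun i => sub_nonneg.2 (hc i).2) hrS'
    have hrG : r ∈ Ideal.span (Set.range c) := inGroup_iff_mem_span_s2.1 ⟨fun i => q i, rfl⟩
    obtain ⟨j, hj⟩ := (hms (k + m - K)).1 <| by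
      rw [show (k + m - K) * s = r - x by linarith]
      exact Ideal.sub_mem _ hrG hxG
    have hrx : r = m * s * j + x := by linear_combination -hq + s * hj
    rcases lt_trichotomy j 0 with hj0 | rfl | hj0
    · have : m * s * j ≤ m * s * (-1) := mul_le_mul_of_nonneg_left (by omega) (by linarith)
      linarith
    · exact hx.2.1 (by simpa [hrx] using hrS)
    · obtain rfl | hj1 : j = 1 ∨ 2 ≤ j := by omega
      · refine hx.2.2 ?_
        rwa [show K * D - r = e - x by rw [hrx]; linear_combination -hk - D * hj] at hrS'
      · have h2 : m * s * 2 ≤ m * s * j := mul_le_mul_of_nonneg_left hj1 (by linarith)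
        have h3 : m * D * 2 ≤ m * D * j := mul_le_mul_of_nonneg_left hj1 (by linarith)
        have h4 : K * D = e + m * s + m * D - m * D * j := by
          linear_combination -hk - D * hj
        linarith
  · rintro u ⟨huG, huS⟩
    by_contra! hlt
    apply huS
    obtain ⟨K, hKG⟩ := (inGroup_add_iff h₀).1 huG
    rw [inGroup_iff_mem_span_s2] at hKG
    have hmspos : 0 < m * s := by linarith
    set y := u - K * s - (C - m * s) with hy
    have hmod := Int.emod_add_mul_ediv y (m * s)
    have hmod0 := Int.emod_nonneg y hmspos.ne'
    have hmod1 := Int.emod_lt_of_pos y hmspos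
    set j := y / (m * s) with hj
    obtain ⟨k', hk'⟩ : ∃ k', k' = K + j * m - m := ⟨_, rfl⟩
    obtain ⟨x', hx'⟩ : ∃ x', x' = u - (k' + m) * s := ⟨_, rfl⟩
    have hx'y : x' = y % (m * s) + C - m * s := by
      rw [hx', hk']; linear_combination -hmod + hy
    have hx'G : x' ∈ Ideal.span (Set.range c) := by
      rw [show x' = (u - K * s) - j * (m * s) by rw [hx', hk']; ring]
      exact Ideal.sub_mem _ hKG (Ideal.mul_mem_left _ _ hmsG)
    have hkk : k ≤ k' := by
      by_contra! hkk
      have : (k' + m) * s ≤ (k + m - 1) * s := mul_le_mul_of_nonneg_right (by omega) hspos.le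
      linarith
    have hkD : k * D ≤ k' * D := mul_le_mul_of_nonneg_right hkk hD.le
    have hklarge : 2 * (n * D) ≤ k := by
      refine le_of_mul_le_mul_right (a := D) ?_ hD
      linarith
    have hcover : InSemigroup c x' ∨ InSemigroup (fun i => D - c i) (k' * D - m * s - x') := by
      by_contra! hnot
      obtain ⟨hle, heq⟩ := hmax (k' * D - m * s) x' ((hdvd _).2 ⟨k', by ring⟩)
        ⟨inGroup_iff_mem_span_s2.2 hx'G, hnot.1, hnot.2⟩
      have hkk' : k' = k :=
        le_antisymm (le_of_mul_le_mul_right (by linarith : k' * D ≤ k * D) hD) hkk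
      subst hkk'
      have := heq (by linarith)
      linarith
    have hc' : ∀ i, 0 ≤ D - c i ∧ D - c i ≤ D := fun i => by have := hc i; omega
    rw [inSemigroup_add_iff]
    rcases hcover with hS | hS'
    · obtain ⟨q, hq, hq'⟩ := exists_combination_of_inSemigroup hD hc h₀ h₁ (k := k' + m)
        (by linarith) hS (inSemigroup_of_inGroup_of_le hD hc' (i₀ := i₁) (i₁ := i₀)
          (by simp [h₁]) (by simp [h₀]) (InGroup.reflect h₀ D (inGroup_iff_mem_span_s2.2
            (Ideal.sub_mem _ (Ideal.mul_mem_left _ _ hDG) hx'G))) (by linarith))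
      exact ⟨q, by rw [hq, hq', hx']; ring⟩
    · obtain ⟨q, hq, hq'⟩ := exists_combination_of_inSemigroup hD hc h₀ h₁ (k := k')
        (r := m * s + x') (by linarith)
        (inSemigroup_of_inGroup_of_le hD hc h₀ h₁
          (inGroup_iff_mem_span_s2.2 (Ideal.add_mem _ hmsG hx'G)) (by linarith))
        (by rwa [← sub_sub])
      exact ⟨q, by rw [hq, hq', hx']; ring⟩

/-- **Corollary (Wagon-type).** For integers `b₁ < b₂ < ⋯ < bₙ` (n ≥ 2), the function
`t ↦ F(t + b₁, …, t + bₙ)` is an eventual quasi-polynomial with period `bₙ - b₁`: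
for each residue `j` mod `bₙ - b₁` there is a polynomial `p_j ∈ ℚ[x]` such that
`F(t + b₁, …, t + bₙ) = p_j(t)` for all sufficiently large `t ≡ j`. -/
theorem frobenius_shifted_eqp (n : ℕ) (hn : 2 ≤ n) (b : Fin n → ℤ)
    (hmono : ∀ i j : Fin n, i < j → b i < b j)
    (Fr : ℕ → ℤ)
    (hFr : ∃ N, ∀ t : ℕ, N ≤ t →
      IsFrobeniusNumber (fun i => (t : ℤ) + b i) (Fr t)) :
    ∃ (N : ℕ) (c : ℕ → Polynomial ℚ),
      ∀ t : ℕ, N ≤ t →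
        (Fr t : ℚ) =
          (c (t % (b ⟨n - 1, by omega⟩ - b ⟨0, by omega⟩).toNat)).eval (t : ℚ) := by
  obtain ⟨N, hN⟩ := hFr
  set i₀ : Fin n := ⟨0, by omega⟩ with hi₀
  set i₁ : Fin n := ⟨n - 1, by omega⟩ with hi₁
  have hb : StrictMono b := fun i j => hmono i j
  have hD : 0 < b i₁ - b i₀ := sub_pos.2 (hmono _ _ (by simp [hi₀, hi₁, Fin.lt_def]; omega))
  set D := b i₁ - b i₀ with hD_def
  have hc : ∀ i, 0 ≤ b i - b i₀ ∧ b i - b i₀ ≤ D := fun i =>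
    ⟨sub_nonneg.2 (hb.monotone (by simp [hi₀, Fin.le_def])),
      sub_le_sub_right (hb.monotone (by simp [hi₁, Fin.le_def]; omega)) _⟩
  choose m e x h using fun j : ℕ => isFrobeniusNumber_shift hD hc (i₀ := i₀) (i₁ := i₁)
    (sub_self _) rfl ((j : ℤ) + b i₀)
  let X : Polynomial ℚ := Polynomial.X + Polynomial.C (b i₀ : ℚ)
  refine ⟨max N (3 * (n * D * D) + 3 * D - b i₀).toNat, fun j =>
    (Polynomial.C ((D : ℚ)⁻¹) * (Polynomial.C (e j : ℚ) + Polynomial.C (m j : ℚ) * X)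
      + Polynomial.C (m j : ℚ)) * X + Polynomial.C (x j : ℚ), fun t ht => ?_⟩
  obtain ⟨htN, htB⟩ := max_le_iff.1 ht
  obtain ⟨k, hk, hF⟩ := h (t % D.toNat) (t + b i₀) (by have := Int.toNat_le.1 htB; linarith) <| by
    rw [Int.natCast_mod, Int.toNat_of_nonneg hD.le]
    refine ⟨t / D, ?_⟩
    linear_combination -Int.emod_add_mul_ediv (t : ℤ) D
  have hFt : IsFrobeniusNumber (fun i => (t : ℤ) + b i₀ + (b i - b i₀)) (Fr t) := by
    simpa using hN t htN
  have hDQ : (D : ℚ) ≠ 0 := by exact_mod_cast hD.ne'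
  have hkQ : (D : ℚ) * k = e (t % D.toNat) + m (t % D.toNat) * (t + b i₀) := by
    exact_mod_cast hk
  rw [hFt.unique hF]
  simp only [X, Polynomial.eval_add, Polynomial.eval_mul, Polynomial.eval_C, Polynomial.eval_X,
    ← hkQ, inv_mul_cancel_left₀ hDQ]
  push_cast
  ring
end

section
/- Let a, b ∈ ℤ be positive and relatively prime, let c ∈ ℤ, and let c = pa + qb be its canonical form (p, q ∈ ℤ with 0 ≤ p < b). Then c ∈ ⟨a, b⟩ if and only if q ≥ 0, where ⟨a, b⟩ = {xa + yb : x, y ∈ ℤ_{≥0}}. -/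
/-- **Canonical form: membership criterion.** If `c = pa + qb` is the canonical form
(`0 ≤ p < b`) with `a, b` coprime and positive, then `c ∈ ⟨a, b⟩` iff `q ≥ 0`. -/
theorem canonical_form_membership (a b : ℤ) (ha : 0 < a) (hb : 0 < b)
    (hco : IsCoprime a b) (c p q : ℤ) (hp0 : 0 ≤ p) (hpb : p < b)
    (hc : c = p * a + q * b) :
    (∃ x y : ℕ, c = (x : ℤ) * a + (y : ℤ) * b) ↔ 0 ≤ q := by
  constructor
  · rintro ⟨x, y, hxy⟩
    have hdvd : b ∣ (x : ℤ) - p :=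
      hco.symm.dvd_of_dvd_mul_right ⟨q - y, by linarith⟩
    obtain ⟨k, hk⟩ := hdvd
    have hk0 : 0 ≤ k := by
      by_contra! h
      nlinarith [Int.natCast_nonneg x]
    have hq : q = y + k * a := by
      apply mul_right_cancel₀ hb.ne'
      linear_combination hxy - hc + a * hk
    rw [hq]
    positivity
  · intro hq
    lift p to ℕ using hp0
    lift q to ℕ using hq
    exact ⟨p, q, hc⟩
end

section
/- Let f, g : ℕ → ℤ be eventual quasi-polynomials with g eventually positive. Then there exist eventual quasi-polynomials q, r : ℕ → ℤ such that f(t) = q(t)g(t) + r(t) and 0 ≤ r(t) < g(t) for all sufficiently large t; moreover deg(r) ≤ deg(g). (This is the analogue over EQP of integer division with remainder.) -/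
open Filter Polynomial

/-- A rational polynomial takes only integer increments along a suitable modulus. -/
theorem Polynomial.exists_modulus_eval_sub_int (Q : ℚ[X]) :
    ∃ D : ℕ, 0 < D ∧ ∀ s t : ℕ, s ≡ t [MOD D] →
      ∃ n : ℤ, Q.eval (s : ℚ) - Q.eval (t : ℚ) = n := by
  induction Q using Polynomial.induction_on' with
  | add p q hp hq =>
    obtain ⟨D, hD, h⟩ := hp
    obtain ⟨E, hE, h'⟩ := hq
    refine ⟨D * E, Nat.mul_pos hD hE, fun s t hst => ?_⟩
    obtain ⟨a, ha⟩ := h s t (hst.of_mul_right E)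
    obtain ⟨b, hb⟩ := h' s t (hst.of_mul_left D)
    refine ⟨a + b, ?_⟩
    push_cast
    rw [← ha, ← hb, eval_add, eval_add]
    ring
  | monomial n a =>
    refine ⟨a.den, a.den_pos, fun s t hst => ?_⟩
    obtain ⟨k, hk⟩ := (Nat.modEq_iff_dvd.1 (hst.pow n).symm)
    refine ⟨a.num * k, ?_⟩
    have hk' : (s : ℚ) ^ n - (t : ℚ) ^ n = a.den * k := by exact_mod_cast hk
    rw [eval_monomial, eval_monomial, ← mul_sub, hk', ← mul_assoc, Rat.mul_den_eq_num]
    push_cast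
    ring

/-- Finitely many rational polynomials share a modulus of integer increments. -/
theorem Polynomial.exists_common_modulus_eval_sub_int (Q : ℕ → ℚ[X]) (m : ℕ) :
    ∃ D : ℕ, 0 < D ∧ ∀ j < m, ∀ s t : ℕ, s ≡ t [MOD D] →
      ∃ n : ℤ, (Q j).eval (s : ℚ) - (Q j).eval (t : ℚ) = n := by
  choose D hD h using fun j => (Q j).exists_modulus_eval_sub_int
  refine ⟨∏ j ∈ Finset.range m, D j, Finset.prod_pos fun j _ => hD j, fun j hj s t hst => ?_⟩
  exact h j s t (hst.of_dvd (Finset.dvd_prod_of_mem D (Finset.mem_range.2 hj)))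

/-- A rational polynomial has eventually constant sign. -/
theorem Polynomial.eventually_nonneg_or_eventually_neg (p : ℚ[X]) :
    (∀ᶠ x in atTop, 0 ≤ p.eval x) ∨ ∀ᶠ x in atTop, p.eval x < 0 := by
  rcases le_or_gt p.degree 0 with hd | hd
  · rw [eq_C_of_degree_le_zero hd]
    simp only [eval_C]
    rcases le_or_gt 0 (p.coeff 0) with h | h
    · exact .inl (.of_forall fun _ => h)
    · exact .inr (.of_forall fun _ => h)
  · rcases le_total 0 p.leadingCoeff with h | h
    · exact .inl ((p.tendsto_atTop_of_leadingCoeff_nonneg hd h).eventually_ge_atTop 0)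
    · exact .inr ((p.tendsto_atBot_of_leadingCoeff_nonpos hd h).eventually_lt_atBot 0)

/-- The error of polynomial division tends to zero. -/
theorem Polynomial.tendsto_eval_div_sub_eval_div (F G : ℚ[X]) :
    Tendsto (fun x => F.eval x / G.eval x - (F / G).eval x) atTop (nhds 0) := by
  rcases eq_or_ne G 0 with rfl | hG
  · simp
  · refine (div_tendsto_atTop_zero_of_degree_lt (F % G) G (degree_mod_lt F hG)).congr' ?_
    filter_upwards [eventually_atTop_not_isRoot G hG] with x hx
    have hx' : G.eval x ≠ 0 := hx
    have h := congrArg (eval x) (EuclideanDomain.div_add_mod F G)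
    rw [eval_add, eval_mul] at h
    rw [← h]
    field_simp
    ring

/-- The error of polynomial division, shifted by a constant, has eventually constant floor. -/
theorem Polynomial.exists_eventually_floor_eq (F G : ℚ[X]) (e : ℚ) :
    ∃ k : ℤ, ∀ᶠ x in atTop, ⌊e + (F.eval x / G.eval x - (F / G).eval x)⌋ = k := by
  have hlim := F.tendsto_eval_div_sub_eval_div G
  rcases eq_or_ne G 0 with rfl | hG
  · exact ⟨⌊e⌋, by simp⟩
  have hlt : ∀ᶠ x in atTop, F.eval x / G.eval x - (F / G).eval x < 1 - Int.fract e :=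
    hlim.eventually_lt_const (sub_pos.2 (Int.fract_lt_one e))
  have hgt : ∀ᶠ x in atTop, -1 < F.eval x / G.eval x - (F / G).eval x :=
    hlim.eventually_const_lt (by norm_num)
  have hfract := Int.fract_nonneg e
  have hsplit := Int.floor_add_fract e
  have hsign : ∀ᶠ x in atTop, 0 < G.eval x ^ 2 ∧
      eval x ((C (Int.fract e) * G + F - (F / G) * G) * G) =
        (Int.fract e + (F.eval x / G.eval x - (F / G).eval x)) * G.eval x ^ 2 := by
    filter_upwards [eventually_atTop_not_isRoot G hG] with x hx
    have hx' : G.eval x ≠ 0 := hx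
    refine ⟨by positivity, ?_⟩
    simp only [eval_mul, eval_sub, eval_add, eval_C]
    field_simp
    ring
  rcases eventually_nonneg_or_eventually_neg
    ((C (Int.fract e) * G + F - (F / G) * G) * G) with h | h
  · refine ⟨⌊e⌋, ?_⟩
    filter_upwards [hlt, hsign, h] with x h1 h2 h3
    rw [h2.2] at h3
    have := nonneg_of_mul_nonneg_left h3 h2.1
    rw [Int.floor_eq_iff]
    constructor <;> linarith
  · refine ⟨⌊e⌋ - 1, ?_⟩
    filter_upwards [hgt, hsign, h] with x h1 h2 h3
    rw [h2.2] at h3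
    have := neg_of_mul_neg_left h3 h2.1.le
    rw [Int.floor_eq_iff]
    push_cast
    constructor <;> linarith

/-- Two eventual quasi-polynomials have representations with a common period. -/
theorem IsEQP.exists_common_period {f g : ℕ → ℤ} (hf : IsEQP f) (hg : IsEQP g) :
    ∃ (N m : ℕ) (c d : ℕ → ℚ[X]), 0 < m ∧ ∀ t : ℕ, N ≤ t →
      (f t : ℚ) = (c (t % m)).eval (t : ℚ) ∧ (g t : ℚ) = (d (t % m)).eval (t : ℚ) := by
  obtain ⟨N, m, c, hm, hc⟩ := hf
  obtain ⟨N', m', d, hm', hd⟩ := hg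
  refine ⟨max N N', m * m', fun j => c (j % m), fun j => d (j % m'), Nat.mul_pos hm hm',
    fun t ht => ⟨?_, ?_⟩⟩
  · simp only [Nat.mod_mul_right_mod]
    exact hc t (le_of_max_le_left ht)
  · simp only [Nat.mod_mul_left_mod]
    exact hd t (le_of_max_le_right ht)

theorem IsEQP.sub {f g : ℕ → ℤ} (hf : IsEQP f) (hg : IsEQP g) : IsEQP (fun t => f t - g t) := by
  obtain ⟨N, m, c, d, hm, h⟩ := hf.exists_common_period hg
  refine ⟨N, m, fun j => c j - d j, hm, fun t ht => ?_⟩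
  rw [Int.cast_sub, (h t ht).1, (h t ht).2, eval_sub]

theorem IsEQP.mul {f g : ℕ → ℤ} (hf : IsEQP f) (hg : IsEQP g) : IsEQP (fun t => f t * g t) := by
  obtain ⟨N, m, c, d, hm, h⟩ := hf.exists_common_period hg
  refine ⟨N, m, fun j => c j * d j, hm, fun t ht => ?_⟩
  rw [Int.cast_mul, (h t ht).1, (h t ht).2, eval_mul]

/-- The floor of a quotient of eventual quasi-polynomials is an eventual quasi-polynomial. -/
theorem IsEQP.floor_div {f g : ℕ → ℤ} (hf : IsEQP f) (hg : IsEQP g) :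
    IsEQP (fun t => ⌊(f t : ℚ) / g t⌋) := by
  obtain ⟨N, m, c, d, hm, h⟩ := hf.exists_common_period hg
  obtain ⟨D, hD, hQ⟩ := exists_common_modulus_eval_sub_int (fun j => c j / d j) m
  choose k hk using fun i : ℕ => exists_eventually_floor_eq (c (i % m)) (d (i % m))
    ((c (i % m) / d (i % m)).eval (i : ℚ))
  have hev : ∀ᶠ t : ℕ in atTop, ∀ i ∈ Finset.range (m * D),
      ⌊(c (i % m) / d (i % m)).eval (i : ℚ) + ((c (i % m)).eval (t : ℚ) / (d (i % m)).eval (t : ℚ)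
        - (c (i % m) / d (i % m)).eval (t : ℚ))⌋ = k i :=
    (Finset.eventually_all _).2 fun i _ => tendsto_natCast_atTop_atTop.eventually (hk i)
  obtain ⟨N', hN'⟩ := eventually_atTop.1 hev
  refine ⟨max N N', m * D, fun i => c (i % m) / d (i % m) -
    C ((c (i % m) / d (i % m)).eval (i : ℚ)) + C (k i : ℚ), Nat.mul_pos hm hD, fun t ht => ?_⟩
  have hfloor := hN' t (le_of_max_le_right ht) (t % (m * D))
    (Finset.mem_range.2 (Nat.mod_lt _ (Nat.mul_pos hm hD)))
  obtain ⟨n, hn⟩ := hQ (t % m) (Nat.mod_lt _ hm) t (t % (m * D))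
    ((Nat.mod_modEq t (m * D)).symm.of_mul_left m)
  obtain ⟨hft, hgt⟩ := h t (le_of_max_le_left ht)
  simp only [Nat.mod_mul_right_mod] at hfloor ⊢
  rw [eval_add, eval_sub, eval_C, eval_C, hn, hft, hgt, ← hfloor, ← Int.cast_add,
    ← Int.floor_intCast_add, ← hn]
  congr 2
  ring

/-- A polynomial dominated by another one along arbitrarily large arguments has no larger
degree. -/
theorem Polynomial.degree_le_of_frequently_abs_eval_le {p q : ℚ[X]}
    (h : ∃ᶠ x in atTop, |p.eval x| ≤ |q.eval x|) : p.degree ≤ q.degree := by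
  by_contra! hlt
  have hp : p ≠ 0 := fun h0 => by simp [h0] at hlt
  have hlim := (div_tendsto_atTop_zero_of_degree_lt q p hlt).abs
  rw [abs_zero] at hlim
  refine h ?_
  filter_upwards [hlim.eventually_lt_const one_pos, eventually_atTop_not_isRoot p hp] with x hx hroot
  have hx' : p.eval x ≠ 0 := hroot
  rw [abs_div, div_lt_one (abs_pos.2 hx')] at hx
  exact hx.not_ge

theorem IsEQP.exists_degLE {f : ℕ → ℤ} (hf : IsEQP f) : ∃ k, EQPDegLE f k := by
  obtain ⟨N, m, c, hm, hc⟩ := hf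
  refine ⟨(Finset.range m).sup fun j => (c j).natDegree, N, m, fun j => c (j % m), hm,
    fun j => ?_, fun t ht => ?_⟩
  · exact degree_le_of_natDegree_le (Finset.le_sup (f := fun j => (c j).natDegree)
      (Finset.mem_range.2 (Nat.mod_lt j hm)))
  · simp only [Nat.mod_mod]
    exact hc t ht

/-- Degree bounds pass to eventually dominated eventual quasi-polynomials. -/
theorem EQPDegLE.of_eventually_abs_le {r g : ℕ → ℤ} {k : ℕ} (hg : EQPDegLE g k) (hr : IsEQP r)
    (h : ∀ᶠ t in atTop, |r t| ≤ |g t|) : EQPDegLE r k := by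
  obtain ⟨N, m, d, hm, hdeg, hd⟩ := hg
  obtain ⟨N', m', c, hm', hc⟩ := hr
  refine ⟨N', m * m', fun j => c (j % m'), Nat.mul_pos hm hm', fun j => ?_, fun t ht => ?_⟩
  · refine (degree_le_of_frequently_abs_eval_le ?_).trans (hdeg (j % m))
    have htend : Tendsto (fun s : ℕ => j + m * m' * s) atTop atTop :=
      tendsto_atTop_mono (fun s => (Nat.le_mul_of_pos_left s (Nat.mul_pos hm hm')).trans
        (Nat.le_add_left _ _)) tendsto_id
    refine (tendsto_natCast_atTop_atTop.comp htend).frequently (Eventually.frequently ?_)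
    filter_upwards [htend.eventually h, htend.eventually_ge_atTop N,
      htend.eventually_ge_atTop N'] with s hs hN hN'
    have h1 := hd _ hN
    have h2 := hc _ hN'
    rw [mul_assoc, Nat.add_mul_mod_self_left, ← mul_assoc] at h1
    rw [mul_right_comm, Nat.add_mul_mod_self_right, mul_right_comm] at h2
    rw [Function.comp_apply, ← h1, ← h2]
    exact_mod_cast hs
  · simp only [Nat.mod_mul_left_mod]
    exact hc t ht

/-- **Lemma (tools, part 3): integer-style division.** For eventual quasi-polynomials
`f, g` with `g` eventually positive, there are eventual quasi-polynomials `q, r` with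
`f = q g + r` and `0 ≤ r < g` eventually; moreover `deg r ≤ deg g`. -/
theorem eqp_integer_division (f g : ℕ → ℤ) (hf : IsEQP f) (hg : IsEQP g)
    (hpos : EventuallyPos g) :
    ∃ q r : ℕ → ℤ, IsEQP q ∧ IsEQP r ∧
      (∃ N, ∀ t : ℕ, N ≤ t → f t = q t * g t + r t ∧ 0 ≤ r t ∧ r t < g t) ∧
      EQPdeg r ≤ EQPdeg g := by
  obtain ⟨N, hN⟩ := hpos
  have hq := hf.floor_div hg
  have hr := hf.sub (hq.mul hg)
  have hbounds : ∀ t : ℕ, N ≤ t → 0 ≤ f t - ⌊(f t : ℚ) / g t⌋ * g t ∧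
      f t - ⌊(f t : ℚ) / g t⌋ * g t < g t := by
    intro t ht
    have hgt : (0 : ℚ) < g t := by exact_mod_cast hN t ht
    have hle := (le_div_iff₀ hgt).1 (Int.floor_le ((f t : ℚ) / g t))
    have hlt := (div_lt_iff₀ hgt).1 (Int.lt_floor_add_one ((f t : ℚ) / g t))
    constructor
    · have : (0 : ℚ) ≤ f t - ⌊(f t : ℚ) / g t⌋ * g t := by linarith
      exact_mod_cast this
    · have : (f t - ⌊(f t : ℚ) / g t⌋ * g t : ℚ) < g t := by linarith
      exact_mod_cast this
  refine ⟨_, _, hq, hr, ⟨N, fun t ht => ⟨by ring, hbounds t ht⟩⟩, Nat.sInf_le ?_⟩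
  have hdeg : EQPDegLE g (EQPdeg g) := Nat.sInf_mem hg.exists_degLE
  refine hdeg.of_eventually_abs_le hr ?_
  filter_upwards [eventually_ge_atTop N] with t ht
  obtain ⟨h0, hlt⟩ := hbounds t ht
  rw [abs_of_nonneg h0]
  exact hlt.le.trans (le_abs_self _)
end

section
/- Let f, g : ℕ → ℤ be eventual quasi-polynomials. Then there exist eventual quasi-polynomials p, q, d : ℕ → ℤ such that for all sufficiently large t, d(t) = gcd(f(t), g(t)) and d(t) = p(t)f(t) + q(t)g(t). In particular, the function t ↦ gcd(f(t), g(t)) is an eventual quasi-polynomial. -/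
open Polynomial

namespace IsEQP

variable {f g : ℕ → ℤ}

/-- Eventual equality to an eventual quasi-polynomial. -/
theorem congr (hf : IsEQP f) (N : ℕ) (h : ∀ t, N ≤ t → g t = f t) : IsEQP g := by
  obtain ⟨N₁, m, c, hm, hc⟩ := hf
  refine ⟨max N N₁, m, c, hm, fun t ht => ?_⟩
  rw [h t (le_trans (le_max_left _ _) ht), hc t (le_trans (le_max_right _ _) ht)]

/-- Eventual quasi-polynomials can be glued along the residue classes of a modulus. -/
theorem glue {m : ℕ} (hm : 0 < m) {h : ℕ → ℕ → ℤ} (hh : ∀ r, IsEQP (h r)) :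
    IsEQP (fun t => h (t % m) t) := by
  choose N k c hk hc using hh
  refine ⟨∑ r ∈ Finset.range m, N r, m * ∏ r ∈ Finset.range m, k r,
    fun j => c (j % m) (j % k (j % m)),
    Nat.mul_pos hm (Finset.prod_pos fun r _ => hk r), fun t ht => ?_⟩
  have hr : t % m ∈ Finset.range m := Finset.mem_range.2 (Nat.mod_lt _ hm)
  have hN : N (t % m) ≤ ∑ r ∈ Finset.range m, N r :=
    Finset.single_le_sum (f := N) (fun _ _ => Nat.zero_le _) hr
  have hdvd : k (t % m) ∣ m * ∏ r ∈ Finset.range m, k r :=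
    (Finset.dvd_prod_of_mem k hr).mul_left m
  simp only [Nat.mod_mod_of_dvd t (dvd_mul_right m _), Nat.mod_mod_of_dvd t hdvd]
  exact hc _ t (hN.trans ht)

theorem of_polynomial (P : ℚ[X]) (h : ∀ t, (f t : ℚ) = P.eval (t : ℚ)) : IsEQP f :=
  ⟨0, 1, fun _ => P, one_pos, fun t _ => h t⟩

theorem eval_intPolynomial (P : ℤ[X]) : IsEQP (fun t => P.eval (t : ℤ)) :=
  of_polynomial (P.map (Int.castRingHom ℚ)) fun t => by
    simp

theorem const (a : ℤ) : IsEQP (fun _ => a) :=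
  of_polynomial (C (a : ℚ)) fun t => by simp

theorem periodic {m : ℕ} (hm : 0 < m) (x : ℕ → ℤ) : IsEQP (fun t => x (t % m)) :=
  glue (h := fun r _ => x r) hm fun r => const (x r)

/-- Two eventual quasi-polynomials have representations with a common period. -/
theorem exists_common_period_s9 (hf : IsEQP f) (hg : IsEQP g) :
    ∃ (N m : ℕ) (c e : ℕ → ℚ[X]), 0 < m ∧ ∀ t, N ≤ t →
      (f t : ℚ) = (c (t % m)).eval (t : ℚ) ∧ (g t : ℚ) = (e (t % m)).eval (t : ℚ) := by
  obtain ⟨N, m, c, hm, hc⟩ := hf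
  obtain ⟨N₁, m₁, e, hm₁, he⟩ := hg
  refine ⟨max N N₁, m * m₁, fun j => c (j % m), fun j => e (j % m₁), Nat.mul_pos hm hm₁,
    fun t ht => ⟨?_, ?_⟩⟩
  · simpa using hc t ((le_max_left _ _).trans ht)
  · simpa using he t ((le_max_right _ _).trans ht)

theorem add (hf : IsEQP f) (hg : IsEQP g) : IsEQP (fun t => f t + g t) := by
  obtain ⟨N, m, c, e, hm, h⟩ := exists_common_period_s9 hf hg
  exact ⟨N, m, fun j => c j + e j, hm, fun t ht => by simp [(h t ht).1, (h t ht).2]⟩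

theorem mul_s9 (hf : IsEQP f) (hg : IsEQP g) : IsEQP (fun t => f t * g t) := by
  obtain ⟨N, m, c, e, hm, h⟩ := exists_common_period_s9 hf hg
  exact ⟨N, m, fun j => c j * e j, hm, fun t ht => by simp [(h t ht).1, (h t ht).2]⟩

theorem sub_s9 (hf : IsEQP f) (hg : IsEQP g) : IsEQP (fun t => f t - g t) :=
  (hf.add ((const (-1)).mul_s9 hg)).congr 0 fun t _ => by ring

theorem ediv_of_dvd {n : ℤ} (hf : IsEQP f) (h : ∀ t, n ∣ f t) :
    IsEQP (fun t => f t / n) := by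
  obtain ⟨N, m, c, hm, hc⟩ := hf
  refine ⟨N, m, fun j => C (n : ℚ)⁻¹ * c j, hm, fun t ht => ?_⟩
  simp only [eval_mul, eval_C, ← hc t ht]
  rw [Rat.intCast_div _ _ (h t), div_eq_inv_mul]

end IsEQP

/-- Bézout coefficients for the values of two integer polynomials that generate a nonzero
constant. -/
theorem exists_isEQP_bezout_of_combination {a b u v : ℤ[X]} {n : ℤ} (hn : n ≠ 0)
    (h : u * a + v * b = C n) :
    ∃ p q : ℕ → ℤ, IsEQP p ∧ IsEQP q ∧ ∀ t : ℕ,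
      (Int.gcd (a.eval (t : ℤ)) (b.eval (t : ℤ)) : ℤ) =
        p t * a.eval (t : ℤ) + q t * b.eval (t : ℤ) := by
  set m := n.natAbs
  have hm : 0 < m := Int.natAbs_pos.2 hn
  have hdvd (P : ℤ[X]) (t : ℕ) : n ∣ P.eval ((t % m : ℕ) : ℤ) - P.eval (t : ℤ) := by
    refine dvd_trans ?_ (sub_dvd_eval_sub _ _ P)
    rw [← Int.natAbs_dvd]
    exact Nat.modEq_iff_dvd.1 (Nat.mod_modEq t m).symm
  let x : ℕ → ℤ := fun j => Int.gcdA (a.eval (j : ℤ)) (b.eval (j : ℤ))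
  let y : ℕ → ℤ := fun j => Int.gcdB (a.eval (j : ℤ)) (b.eval (j : ℤ))
  let G : ℕ → ℤ := fun j => Int.gcd (a.eval (j : ℤ)) (b.eval (j : ℤ))
  have hG (j : ℕ) : G j = a.eval (j : ℤ) * x j + b.eval (j : ℤ) * y j := Int.gcd_eq_gcd_ab _ _
  have huv (t : ℕ) : u.eval (t : ℤ) * a.eval (t : ℤ) + v.eval (t : ℤ) * b.eval (t : ℤ) = n := by
    simpa using congrArg (eval (t : ℤ)) h
  have hGdvd (s t : ℕ) (hst : ∀ P : ℤ[X], n ∣ P.eval (t : ℤ) - P.eval (s : ℤ)) : G s ∣ G t := by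
    have hGn : G s ∣ n := huv s ▸ dvd_add ((Int.gcd_dvd_left _ _).mul_left _)
      ((Int.gcd_dvd_right _ _).mul_left _)
    exact Int.dvd_coe_gcd ((dvd_iff_dvd_of_dvd_sub (hGn.trans (hst a))).2 (Int.gcd_dvd_left _ _))
      ((dvd_iff_dvd_of_dvd_sub (hGn.trans (hst b))).2 (Int.gcd_dvd_right _ _))
  have hGper (t : ℕ) : G t = G (t % m) :=
    Int.dvd_antisymm (Int.natCast_nonneg _) (Int.natCast_nonneg _)
      (hGdvd _ _ fun P => hdvd P t) (hGdvd _ _ fun P => dvd_sub_comm.1 (hdvd P t))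
  let w : ℕ → ℤ := fun t =>
    x (t % m) * ((a.eval ((t % m : ℕ) : ℤ) - a.eval (t : ℤ)) / n) +
      y (t % m) * ((b.eval ((t % m : ℕ) : ℤ) - b.eval (t : ℤ)) / n)
  have hquot (P : ℤ[X]) : IsEQP fun t => (P.eval ((t % m : ℕ) : ℤ) - P.eval (t : ℤ)) / n :=
    ((IsEQP.periodic hm fun j => P.eval (j : ℤ)).sub_s9 (.eval_intPolynomial P)).ediv_of_dvd (hdvd P)
  have hw : IsEQP w :=
    ((IsEQP.periodic hm x).mul_s9 (hquot a)).add ((IsEQP.periodic hm y).mul_s9 (hquot b))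
  refine ⟨fun t => x (t % m) + w t * u.eval (t : ℤ), fun t => y (t % m) + w t * v.eval (t : ℤ),
    (IsEQP.periodic hm x).add (hw.mul_s9 (.eval_intPolynomial u)),
    (IsEQP.periodic hm y).add (hw.mul_s9 (.eval_intPolynomial v)), fun t => ?_⟩
  change G t = _
  have hwn : w t * n = x (t % m) * (a.eval ((t % m : ℕ) : ℤ) - a.eval (t : ℤ)) +
      y (t % m) * (b.eval ((t % m : ℕ) : ℤ) - b.eval (t : ℤ)) := by
    simp only [w, add_mul, mul_assoc, Int.ediv_mul_cancel (hdvd _ t)]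
  rw [hGper, hG]
  linear_combination -(w t) * huv t - hwn

theorem exists_int_multiple (P : ℚ[X]) :
    ∃ (k : ℤ) (p : ℤ[X]), k ≠ 0 ∧ p.map (Int.castRingHom ℚ) = C (k : ℚ) * P := by
  obtain ⟨k, hk, hP⟩ := IsLocalization.integerNormalization_spec (nonZeroDivisors ℤ) P
  refine ⟨k, _, nonZeroDivisors.ne_zero hk, hP.trans ?_⟩
  ext i
  simp

/-- The values of a rational polynomial eventually have constant sign. -/
theorem exists_sign_eventually (E : ℚ[X]) :
    ∃ (s : ℤ) (N : ℕ), (s = 1 ∨ s = -1) ∧ ∀ t : ℕ, N ≤ t → 0 ≤ (s : ℚ) * E.eval (t : ℚ) := by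
  have key (P : ℚ[X]) (hP : 0 ≤ P.leadingCoeff) : ∃ N : ℕ, ∀ t : ℕ, N ≤ t → 0 ≤ P.eval (t : ℚ) := by
    rcases lt_or_ge 0 P.degree with hd | hd
    · exact Filter.eventually_atTop.1 (((P.tendsto_atTop_of_leadingCoeff_nonneg hd hP).comp
        tendsto_natCast_atTop_atTop).eventually_ge_atTop 0)
    · rw [eq_C_of_degree_le_zero hd] at hP ⊢
      exact ⟨0, fun t _ => by simpa using hP⟩
  rcases le_total 0 E.leadingCoeff with hE | hE
  · obtain ⟨N, hN⟩ := key E hE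
    exact ⟨1, N, .inl rfl, by simpa using hN⟩
  · obtain ⟨N, hN⟩ := key (-E) (by simpa using hE)
    exact ⟨-1, N, .inr rfl, by simpa using hN⟩

/-- Two rational polynomials are a common multiple of integer polynomials that generate a nonzero
constant. -/
theorem exists_intPolynomial_factorization (F G : ℚ[X]) :
    ∃ (a b u v : ℤ[X]) (n : ℤ) (E : ℚ[X]), n ≠ 0 ∧ u * a + v * b = C n ∧
      F = a.map (Int.castRingHom ℚ) * E ∧ G = b.map (Int.castRingHom ℚ) * E := by
  obtain ⟨D, A, B, hAB, hF, hG⟩ : ∃ D A B : ℚ[X], IsCoprime A B ∧ F = A * D ∧ G = B * D := by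
    by_cases hG : G = 0
    · exact ⟨F, 1, 0, isCoprime_one_left, by simp, by simp [hG]⟩
    · let := EuclideanDomain.gcdMonoid ℚ[X]
      have hD : GCDMonoid.gcd F G ≠ 0 := gcd_ne_zero_of_right hG
      exact ⟨GCDMonoid.gcd F G, F / GCDMonoid.gcd F G, G / GCDMonoid.gcd F G,
        isCoprime_div_gcd_div_gcd hG,
        ((mul_comm _ _).trans (EuclideanDomain.mul_div_cancel' hD (gcd_dvd_left F G))).symm,
        ((mul_comm _ _).trans (EuclideanDomain.mul_div_cancel' hD (gcd_dvd_right F G))).symm⟩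
  obtain ⟨U, V, hUV⟩ := hAB
  obtain ⟨kA, a, hkA, ha⟩ := exists_int_multiple A
  obtain ⟨kB, b, hkB, hb⟩ := exists_int_multiple B
  obtain ⟨kU, u, hkU, hu⟩ := exists_int_multiple U
  obtain ⟨kV, v, hkV, hv⟩ := exists_int_multiple V
  have hinv : C ((kA : ℚ) * kB) * C ((kA : ℚ) * kB)⁻¹ = (1 : ℚ[X]) := by
    rw [← C_mul, mul_inv_cancel₀ (by simp [hkA, hkB]), C_1]
  refine ⟨C kB * a, C kA * b, C kV * u, C kU * v, kA * kB * kU * kV,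
    C ((kA : ℚ) * kB)⁻¹ * D, by simp [hkA, hkB, hkU, hkV], ?_, ?_, ?_⟩
  · apply map_injective (Int.castRingHom ℚ) Int.cast_injective
    simp only [Polynomial.map_add, Polynomial.map_mul, ha, hb, hu, hv, map_C, Int.coe_castRingHom,
      C_mul]
    linear_combination C (kA : ℚ) * C (kB : ℚ) * C (kU : ℚ) * C (kV : ℚ) * hUV
  · simp only [Polynomial.map_mul, ha, map_C, Int.coe_castRingHom, hF, C_mul] at hinv ⊢
    linear_combination - (A * D) * hinv
  · simp only [Polynomial.map_mul, hb, map_C, Int.coe_castRingHom, hG, C_mul] at hinv ⊢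
    linear_combination - (B * D) * hinv

/-- Bézout coefficients for the integral values of two rational polynomials. -/
theorem exists_isEQP_bezout_of_polynomial (F G : ℚ[X]) :
    ∃ p q : ℕ → ℤ, IsEQP p ∧ IsEQP q ∧ ∃ N : ℕ, ∀ t : ℕ, N ≤ t → ∀ x y : ℤ,
      (x : ℚ) = F.eval (t : ℚ) → (y : ℚ) = G.eval (t : ℚ) →
        (Int.gcd x y : ℤ) = p t * x + q t * y := by
  obtain ⟨a, b, u, v, n, E, hn, huv, rfl, rfl⟩ := exists_intPolynomial_factorization F G
  obtain ⟨p, q, hp, hq, hpq⟩ := exists_isEQP_bezout_of_combination hn huv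
  obtain ⟨s, N, hs, hN⟩ := exists_sign_eventually E
  refine ⟨fun t => s * p t, fun t => s * q t, (IsEQP.const s).mul_s9 hp, (IsEQP.const s).mul_s9 hq,
    N, fun t ht x y hx hy => ?_⟩
  have heval (P : ℤ[X]) : (P.map (Int.castRingHom ℚ)).eval (t : ℚ) = (P.eval (t : ℤ) : ℤ) := by
    simp
  rw [eval_mul, heval] at hx hy
  have hγ := hpq t
  set α := a.eval (t : ℤ)
  set β := b.eval (t : ℤ)
  obtain ⟨α₁, hα⟩ := Int.gcd_dvd_left α β
  obtain ⟨β₁, hβ⟩ := Int.gcd_dvd_right α β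
  set γ := Int.gcd α β
  set w := p t * x + q t * y with hw
  have hwE : (w : ℚ) = γ * E.eval (t : ℚ) := by
    have : (γ : ℚ) = p t * α + q t * β := by exact_mod_cast hγ
    rw [hw, this]
    push_cast
    rw [hx, hy]
    ring
  have hxw : x = α₁ * w := by
    have : (α : ℚ) = γ * α₁ := by exact_mod_cast hα
    have : (x : ℚ) = α₁ * w := by rw [hx, hwE, this]; ring
    exact_mod_cast this
  have hyw : y = β₁ * w := by
    have : (β : ℚ) = γ * β₁ := by exact_mod_cast hβ
    have : (y : ℚ) = β₁ * w := by rw [hy, hwE, this]; ring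
    exact_mod_cast this
  have hsw : 0 ≤ s * w := by
    have : (0 : ℚ) ≤ s * w := by
      rw [hwE, mul_left_comm]
      exact mul_nonneg (Nat.cast_nonneg _) (hN t ht)
    exact_mod_cast this
  have hsdvd (z : ℤ) (hz : w ∣ z) : s * w ∣ z := by
    rcases hs with rfl | rfl <;> simpa using hz
  have hgoal : s * p t * x + s * q t * y = s * w := by rw [hw]; ring
  simp only [hgoal]
  refine Int.dvd_antisymm (Int.natCast_nonneg _) hsw ?_
    (Int.dvd_coe_gcd (hsdvd x ⟨α₁, by rw [hxw]; ring⟩) (hsdvd y ⟨β₁, by rw [hyw]; ring⟩))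
  exact (dvd_add ((Int.gcd_dvd_left x y).mul_left _) ((Int.gcd_dvd_right x y).mul_left _)).mul_left s

/-- **Lemma (tools, part 4): gcd and Bézout.** For eventual quasi-polynomials `f, g`
there are eventual quasi-polynomials `p, q, d` with, eventually,
`d(t) = gcd(f(t), g(t))` and `d(t) = p(t) f(t) + q(t) g(t)`. In particular
`t ↦ gcd(f(t), g(t))` is an eventual quasi-polynomial. -/
theorem eqp_gcd_bezout (f g : ℕ → ℤ) (hf : IsEQP f) (hg : IsEQP g) :
    (∃ p q d : ℕ → ℤ, IsEQP p ∧ IsEQP q ∧ IsEQP d ∧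
      ∃ N, ∀ t : ℕ, N ≤ t →
        d t = (Int.gcd (f t) (g t) : ℤ) ∧ d t = p t * f t + q t * g t) ∧
    IsEQP (fun t => (Int.gcd (f t) (g t) : ℤ)) := by
  obtain ⟨N, m, c, e, hm, hce⟩ := hf.exists_common_period_s9 hg
  choose p q hp hq M hM using fun r => exists_isEQP_bezout_of_polynomial (c r) (e r)
  have hP : IsEQP fun t => p (t % m) t := .glue hm hp
  have hQ : IsEQP fun t => q (t % m) t := .glue hm hq
  have hbez : ∀ t, N + ∑ r ∈ Finset.range m, M r ≤ t →
      (Int.gcd (f t) (g t) : ℤ) = p (t % m) t * f t + q (t % m) t * g t := fun t ht => by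
    have hMr : M (t % m) ≤ ∑ r ∈ Finset.range m, M r :=
      Finset.single_le_sum (f := M) (fun _ _ => Nat.zero_le _)
        (Finset.mem_range.2 (Nat.mod_lt _ hm))
    obtain ⟨hft, hgt⟩ := hce t (by omega)
    exact hM (t % m) t (by omega) _ _ hft hgt
  have hgcd : IsEQP fun t => (Int.gcd (f t) (g t) : ℤ) :=
    ((hP.mul_s9 hf).add (hQ.mul_s9 hg)).congr _ hbez
  exact ⟨⟨_, _, _, hP, hQ, hgcd, _, fun t ht => ⟨rfl, hbez t ht⟩⟩, hgcd⟩
end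

section
/- Let f, g : ℕ → ℤ be eventual quasi-polynomials. Then the function t ↦ max(f(t), g(t)) is an eventual quasi-polynomial. -/
open Filter in
/-- A rational polynomial eventually has constant (weak) sign at infinity. -/
theorem Polynomial.eventually_nonneg_or_eventually_nonpos (P : Polynomial ℚ) :
    (∀ᶠ x in atTop, 0 ≤ P.eval x) ∨ (∀ᶠ x in atTop, P.eval x ≤ 0) := by
  rcases le_or_gt P.degree 0 with hdeg | hdeg
  · rw [Polynomial.eq_C_of_degree_le_zero hdeg]
    simp only [Polynomial.eval_C]
    exact (le_total 0 (P.coeff 0)).imp (fun h => .of_forall fun _ => h)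
      (fun h => .of_forall fun _ => h)
  · rcases le_total 0 P.leadingCoeff with h | h
    · exact .inl ((P.tendsto_atTop_of_leadingCoeff_nonneg hdeg h).eventually_ge_atTop 0)
    · exact .inr ((P.tendsto_atBot_of_leadingCoeff_nonpos hdeg h).eventually_le_atBot 0)

open Filter in
/-- The pointwise maximum of two rational polynomials eventually agrees with a polynomial. -/
theorem Polynomial.exists_eventually_max_eval_eq (P Q : Polynomial ℚ) :
    ∃ R : Polynomial ℚ, ∀ᶠ x in atTop, max (P.eval x) (Q.eval x) = R.eval x := by
  rcases (P - Q).eventually_nonneg_or_eventually_nonpos with h | h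
  · refine ⟨P, h.mono fun x hx => max_eq_left ?_⟩
    simpa using hx
  · refine ⟨Q, h.mono fun x hx => max_eq_right ?_⟩
    simpa using hx

/-- **Lemma (tools, part 5): maximum.** The pointwise maximum of two eventual
quasi-polynomials is an eventual quasi-polynomial. -/
theorem eqp_max (f g : ℕ → ℤ) (hf : IsEQP f) (hg : IsEQP g) :
    IsEQP (fun t => max (f t) (g t)) := by
  obtain ⟨Nf, m, c, hm, hf⟩ := hf
  obtain ⟨Ng, n, d, hn, hg⟩ := hg
  choose R hR using fun j =>
    Polynomial.exists_eventually_max_eval_eq (c (j % m)) (d (j % n))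
  have hall : ∀ᶠ t : ℕ in Filter.atTop, ∀ j ∈ Finset.range (m * n),
      max ((c (j % m)).eval (t : ℚ)) ((d (j % n)).eval (t : ℚ)) = (R j).eval (t : ℚ) :=
    (Filter.eventually_all_finset _).2 fun j _ =>
      tendsto_natCast_atTop_atTop.eventually (hR j)
  obtain ⟨N, hN⟩ := Filter.eventually_atTop.1 hall
  refine ⟨max N (max Nf Ng), m * n, R, Nat.mul_pos hm hn, fun t ht => ?_⟩
  simp only [max_le_iff] at ht
  have h := hN t ht.1 (t % (m * n)) (Finset.mem_range.2 (Nat.mod_lt _ (Nat.mul_pos hm hn)))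
  rw [Nat.mod_mul_right_mod, Nat.mod_mul_left_mod] at h
  rw [Int.cast_max, hf t ht.2.1, hg t ht.2.2, h]
end

section
/- For 1 ≤ i ≤ n, let a_i(t) = α_i t + β_i with either α_i a positive integer and β_i ∈ ℤ, or α_i = 0 and β_i a positive integer; suppose β_i α_j ≤ β_j α_i whenever i ≤ j, and that β_1 α_n < β_n α_1. Then there exists a finite set H of integer-valued polynomials of degree at most 1 such that 0 ∈ H, every nonzero h ∈ H is eventually positive, and for all sufficiently large t (in particular, large enough that a_i(t) > 0 for all i), ⟨a_1(t), ..., a_n(t)⟩ = ⋃_{h ∈ H} ( h(t) + ⟨a_1(t), a_n(t)⟩ ). Explicitly, one may take H = { λ_2 a_2 + ⋯ + λ_{n−1} a_{n−1} : λ_i ∈ ℤ_{≥0}, λ_i < β_n α_1 − β_1 α_n }. -/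
/-- Affine functions `t ↦ αᵢ t + βᵢ` of the admissible form are simultaneously positive
for large `t`. -/
theorem exists_forall_affine_pos {ι : Type*} [Fintype ι] (α β : ι → ℤ)
    (hform : ∀ i, 0 < α i ∨ (α i = 0 ∧ 0 < β i)) :
    ∃ N : ℕ, ∀ t : ℕ, N ≤ t → ∀ i, 0 < α i * (t : ℤ) + β i := by
  refine ⟨∑ i, (β i).natAbs + 1, fun t ht i => ?_⟩
  have hle : (β i).natAbs ≤ ∑ j, (β j).natAbs :=
    Finset.single_le_sum (f := fun j => (β j).natAbs) (fun _ _ => Nat.zero_le _)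
      (Finset.mem_univ i)
  have hlt : -β i < (t : ℤ) := by omega
  rcases hform i with h | ⟨h, h'⟩
  · nlinarith [Int.natCast_nonneg t]
  · simpa [h] using h'

theorem sum_mul_affine {ι : Type*} [Fintype ι] (c α β : ι → ℤ) (t : ℤ) :
    ∑ i, c i * (α i * t + β i) = (∑ i, c i * α i) * t + ∑ i, c i * β i := by
  rw [Finset.sum_mul, ← Finset.sum_add_distrib]
  exact Finset.sum_congr rfl fun i _ => by ring

/-- The pairs `∑ i, cᵢ (αᵢ, βᵢ)` with coefficients in `[0, D)` form a finite set. -/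
theorem finite_bounded_combinations {ι : Type*} [Fintype ι] (α β : ι → ℤ) (D : ℤ) :
    {h : ℤ × ℤ | ∃ c : ι → ℤ, (∀ i, 0 ≤ c i ∧ c i < D) ∧
      h = (∑ i, c i * α i, ∑ i, c i * β i)}.Finite := by
  have hfin : (Set.univ.pi fun _ : ι => Set.Ico (0 : ℤ) D).Finite :=
    Set.Finite.pi fun _ => Set.finite_Ico _ _
  refine (hfin.image fun c => (∑ i, c i * α i, ∑ i, c i * β i)).subset ?_
  rintro h ⟨c, hc, rfl⟩
  exact ⟨c, fun i _ => hc i, rfl⟩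

/-- If `D aᵢ = cᵢ aₖ + dᵢ aₗ` with `cᵢ, dᵢ ≥ 0`, then every nonnegative combination of the `aᵢ`
can be rewritten so that all coefficients other than those of `aₖ` and `aₗ` are less than `D`. -/
theorem exists_reduced_combination_s12 {ι : Type*} [Fintype ι] {D : ℤ} (hD : 0 < D) {k l : ι}
    {a c d : ι → ℤ} (hc : ∀ i, 0 ≤ c i) (hd : ∀ i, 0 ≤ d i)
    (hrel : ∀ i, D * a i = c i * a k + d i * a l) (p : ι → ℕ) :
    ∃ lam : ι → ℤ, (∀ i, 0 ≤ lam i ∧ lam i < D) ∧ lam k = 0 ∧ lam l = 0 ∧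
      ∃ x y : ℕ, ∑ i, (p i : ℤ) * a i = ∑ i, lam i * a i + x * a k + y * a l := by
  have hterm : ∀ i, ∃ m x y : ℤ, (0 ≤ m ∧ m < D) ∧ (i = k ∨ i = l → m = 0) ∧ 0 ≤ x ∧ 0 ≤ y ∧
      (p i : ℤ) * a i = m * a i + x * a k + y * a l := by
    intro i
    by_cases hik : i = k
    · exact ⟨0, p i, 0, ⟨le_rfl, hD⟩, fun _ => rfl, by positivity, le_rfl, by rw [hik]; ring⟩
    by_cases hil : i = l
    · exact ⟨0, 0, p i, ⟨le_rfl, hD⟩, fun _ => rfl, le_rfl, by positivity, by rw [hil]; ring⟩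
    have hq : 0 ≤ (p i : ℤ) / D := Int.ediv_nonneg (by positivity) hD.le
    refine ⟨p i % D, p i / D * c i, p i / D * d i,
      ⟨Int.emod_nonneg _ hD.ne', Int.emod_lt_of_pos _ hD⟩, by tauto,
      mul_nonneg hq (hc i), mul_nonneg hq (hd i), ?_⟩
    linear_combination (p i / D : ℤ) * hrel i - a i * Int.emod_add_mul_ediv (p i) D
  choose m x y hm hm0 hx hy hsum using hterm
  refine ⟨m, hm, hm0 k (.inl rfl), hm0 l (.inr rfl), (∑ i, x i).toNat, (∑ i, y i).toNat, ?_⟩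
  rw [Int.toNat_of_nonneg (Finset.sum_nonneg fun i _ => hx i),
    Int.toNat_of_nonneg (Finset.sum_nonneg fun i _ => hy i), Finset.sum_mul, Finset.sum_mul,
    ← Finset.sum_add_distrib, ← Finset.sum_add_distrib]
  exact Finset.sum_congr rfl fun i _ => hsum i

theorem inSemigroup_of_combination_add {n : ℕ} (a : Fin n → ℤ) (k l : Fin n) {lam : Fin n → ℤ}
    (hlam : ∀ i, 0 ≤ lam i) (x y : ℕ) :
    InSemigroup a (∑ i, lam i * a i + x * a k + y * a l) := by
  refine ⟨fun i => (lam i).toNat + (if i = k then x else 0) + (if i = l then y else 0), ?_⟩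
  simp [add_mul, Finset.sum_add_distrib, ite_mul, hlam]

/-- **Lemma (covering).** With `aᵢ(t) = αᵢ t + βᵢ` ordered so that
`βᵢ αⱼ ≤ βⱼ αᵢ` for `i ≤ j`, and `β₁ αₙ < βₙ α₁`, the explicit finite set
`H = {λ₂ a₂ + ⋯ + λ_{n-1} a_{n-1} : 0 ≤ λᵢ < βₙ α₁ - β₁ αₙ}` of integer-valued
polynomials of degree ≤ 1 (coded as pairs `(h₁, h₂)` meaning `t ↦ h₁ t + h₂`)
contains 0, its nonzero elements are eventually positive, and for all large `t`,
`⟨a₁(t), …, aₙ(t)⟩ = ⋃_{h ∈ H} (h(t) + ⟨a₁(t), aₙ(t)⟩)`. -/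
theorem frobenius_covering_lemma (n : ℕ) (hn : 1 ≤ n) (α β : Fin n → ℤ)
    (hform : ∀ i, 0 < α i ∨ (α i = 0 ∧ 0 < β i))
    (horder : ∀ i j : Fin n, i ≤ j → β i * α j ≤ β j * α i)
    (hnd : β ⟨0, by omega⟩ * α ⟨n - 1, by omega⟩ <
           β ⟨n - 1, by omega⟩ * α ⟨0, by omega⟩) :
    ∃ H : Set (ℤ × ℤ), H.Finite ∧ ((0, 0) : ℤ × ℤ) ∈ H ∧
      (∀ h ∈ H, h ≠ (0, 0) → ∃ N : ℕ, ∀ t : ℕ, N ≤ t → 0 < h.1 * t + h.2) ∧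
      H = {h : ℤ × ℤ | ∃ lam : Fin n → ℤ,
            (∀ i, 0 ≤ lam i ∧
              lam i < β ⟨n - 1, by omega⟩ * α ⟨0, by omega⟩ -
                      β ⟨0, by omega⟩ * α ⟨n - 1, by omega⟩) ∧
            lam ⟨0, by omega⟩ = 0 ∧ lam ⟨n - 1, by omega⟩ = 0 ∧
            h = (∑ i, lam i * α i, ∑ i, lam i * β i)} ∧
      ∃ N : ℕ, ∀ t : ℕ, N ≤ t → (∀ i, 0 < α i * t + β i) ∧
        ∀ u : ℤ, InSemigroup (fun i => α i * (t : ℤ) + β i) u ↔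
          ∃ h ∈ H, ∃ x y : ℕ,
            u = (h.1 * t + h.2)
              + (x : ℤ) * (α ⟨0, by omega⟩ * t + β ⟨0, by omega⟩)
              + (y : ℤ) * (α ⟨n - 1, by omega⟩ * t + β ⟨n - 1, by omega⟩) := by
  obtain ⟨N, hN⟩ := exists_forall_affine_pos α β hform
  set k : Fin n := ⟨0, by omega⟩
  set l : Fin n := ⟨n - 1, by omega⟩
  have hD : 0 < β l * α k - β k * α l := by linarith
  refine ⟨_, ?_, ?_, ?_, rfl, N, fun t ht => ⟨hN t ht, fun u => ⟨?_, ?_⟩⟩⟩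
  · exact (finite_bounded_combinations α β (β l * α k - β k * α l)).subset
      fun h ⟨lam, hlam, _, _, hh⟩ => ⟨lam, hlam, hh⟩
  · exact ⟨0, fun _ => ⟨le_rfl, hD⟩, rfl, rfl, by simp⟩
  · rintro h ⟨lam, hlam, -, -, rfl⟩ hne
    obtain ⟨i, hi⟩ : ∃ i, lam i ≠ 0 := by
      by_contra! hzero
      exact hne (by simp [hzero])
    refine ⟨N, fun t ht => ?_⟩
    rw [← sum_mul_affine]
    exact Finset.sum_pos' (fun j _ => mul_nonneg (hlam j).1 (hN t ht j).le)
      ⟨i, Finset.mem_univ i, mul_pos (lt_of_le_of_ne (hlam i).1 hi.symm) (hN t ht i)⟩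
  · rintro ⟨p, rfl⟩
    obtain ⟨lam, hlam, hlamk, hlaml, x, y, hsum⟩ :=
      exists_reduced_combination_s12 hD (k := k) (l := l) (a := fun i => α i * (t : ℤ) + β i)
        (c := fun i => β l * α i - β i * α l) (d := fun i => β i * α k - β k * α i)
        (fun i => sub_nonneg.2 (horder i l (Fin.le_def.2 (Nat.le_sub_one_of_lt i.2))))
        (fun i => sub_nonneg.2 (horder k i (Fin.le_def.2 (Nat.zero_le _))))
        (fun i => by ring) p
    exact ⟨_, ⟨lam, hlam, hlamk, hlaml, rfl⟩, x, y, by rw [hsum, sum_mul_affine]⟩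
  · rintro ⟨h, ⟨lam, hlam, -, -, rfl⟩, x, y, rfl⟩
    rw [← sum_mul_affine]
    exact inSemigroup_of_combination_add (fun i => α i * (t : ℤ) + β i) k l
      (fun i => (hlam i).1) x y
end
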